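/- arXiv:1609.08801 — 3 statements merged into one kernel-verified Lean document; each statement's English description precedes it below -/
import Mathlib

section
/- There exists a universal constant C > 0 such that for every weighted graph G = (V,E,w), every subset K ⊆ V of size k ≥ 2, and every parameter 0 < δ < 1, there exists a spanner H of G that (1) contains the minimum spanning tree MST(G), (2) has lightness Ψ(H) ≤ 1 + δ, and (3) satisfies d_H(u,v) ≤ (C·log(k)/δ) · d_G(u,v) for every pair (u,v) ∈ K × V. -/
open Finset

attribute [local instance] Classical.propDecidable

section Defs

variable {V : Type*} [Fintype V]

/-- Total weight of a (sub)graph: the sum of its edge weights. -/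
noncomputable def wWeight (H : SimpleGraph V) (w : Sym2 V → ℝ) : ℝ :=
  ∑ e ∈ H.edgeSet.toFinite.toFinset, w e

/-- Shortest-path distance in a weighted graph: infimum of walk weights. -/
noncomputable def wdist (G : SimpleGraph V) (w : Sym2 V → ℝ) (u v : V) : ℝ :=
  sInf {x : ℝ | ∃ p : G.Walk u v, x = (p.edges.map w).sum}

/-- `T` is a spanning tree of `G`. -/
def IsSpanningTree (G T : SimpleGraph V) : Prop :=
  T ≤ G ∧ T.IsTree

/-- Weight of a minimum spanning tree of `G`. -/
noncomputable def mstWeight (G : SimpleGraph V) (w : Sym2 V → ℝ) : ℝ :=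
  sInf {x : ℝ | ∃ T : SimpleGraph V, IsSpanningTree G T ∧ x = wWeight T w}

/-- `T` is a minimum spanning tree of `G`. -/
def IsMST (G : SimpleGraph V) (w : Sym2 V → ℝ) (T : SimpleGraph V) : Prop :=
  IsSpanningTree G T ∧ ∀ T' : SimpleGraph V, IsSpanningTree G T' → wWeight T w ≤ wWeight T' w

/-- A spanner of `G`: a connected spanning subgraph. -/
def IsSpanner (G H : SimpleGraph V) : Prop := H ≤ G ∧ H.Connected

/-- `G` together with `w` is a weighted graph: connected, positive pairwise-distinct
edge weights. -/
def IsWeightedGraph (G : SimpleGraph V) (w : Sym2 V → ℝ) : Prop :=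
  G.Connected ∧ (∀ e ∈ G.edgeSet, 0 < w e) ∧
    (∀ e ∈ G.edgeSet, ∀ e' ∈ G.edgeSet, e ≠ e' → w e ≠ w e')

/-- The ordered pairs of distinct vertices whose distortion in `H` is at most `t`. -/
noncomputable def goodPairs (G H : SimpleGraph V) (w : Sym2 V → ℝ) (t : ℝ) : Finset (V × V) :=
  Finset.univ.offDiag.filter (fun p => wdist H w p.1 p.2 ≤ t * wdist G w p.1 p.2)

/-- Scaling distortion `γ`: for every `ε ∈ (0,1)`, at least a `(1-ε)` fraction of the
pairs of distinct vertices have distortion at most `γ ε`.  (Counted over ordered pairs: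
`n·(n-1) = 2·(n choose 2)`.) -/
def HasScalingDistortion (G H : SimpleGraph V) (w : Sym2 V → ℝ) (γ : ℝ → ℝ) : Prop :=
  ∀ ε : ℝ, 0 < ε → ε < 1 →
    (1 - ε) * ((Fintype.card V : ℝ) * ((Fintype.card V : ℝ) - 1)) ≤
      ((goodPairs G H w (γ ε)).card : ℝ)

/-- The `ℓ_q`-distortion of the spanner `H` of `G`. -/
noncomputable def distq (G H : SimpleGraph V) (w : Sym2 V → ℝ) (q : ℝ) : ℝ :=
  ((∑ p ∈ (Finset.univ : Finset V).offDiag, (wdist H w p.1 p.2 / wdist G w p.1 p.2) ^ q) /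
    ((Fintype.card V : ℝ) * ((Fintype.card V : ℝ) - 1))) ^ (1 / q)

/-- `R(v,ε)`: the minimal radius `r` such that the ball `B(v,r)` contains at least `εn`
vertices. -/
noncomputable def Rgraph (G : SimpleGraph V) (w : Sym2 V → ℝ) (v : V) (ε : ℝ) : ℝ :=
  sInf {r : ℝ | 0 ≤ r ∧
    ε * (Fintype.card V : ℝ) ≤ ((Finset.univ.filter (fun u => wdist G w u v ≤ r)).card : ℝ)}

/-- Coarse scaling distortion `γ`: every pair of distinct vertices that are mutually
`ε/2`-far has distortion at most `γ ε`. -/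
def HasCoarseScalingDistortion (G H : SimpleGraph V) (w : Sym2 V → ℝ) (γ : ℝ → ℝ) : Prop :=
  ∀ ε : ℝ, 0 < ε → ε < 1 → ∀ u v : V, u ≠ v →
    Rgraph G w v (ε / 2) ≤ wdist G w u v → Rgraph G w u (ε / 2) ≤ wdist G w u v →
    wdist H w u v ≤ γ ε * wdist G w u v

end Defs

/-- The total weight of a walk. -/
noncomputable def walkWeight {V : Type*} {G : SimpleGraph V} (w : Sym2 V → ℝ) {u v : V}
    (p : G.Walk u v) : ℝ :=
  (p.edges.map w).sum

section WalkWeight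

variable {V : Type*} {G H : SimpleGraph V} {w : Sym2 V → ℝ} {a b u v x y : V}

@[simp] lemma walkWeight_nil : walkWeight w (SimpleGraph.Walk.nil : G.Walk u u) = 0 := by
  simp [walkWeight]

@[simp] lemma walkWeight_cons (h : G.Adj u v) (p : G.Walk v x) :
    walkWeight w (SimpleGraph.Walk.cons h p) = w s(u, v) + walkWeight w p := by
  simp [walkWeight]

@[simp] lemma walkWeight_append (p : G.Walk u v) (q : G.Walk v x) :
    walkWeight w (p.append q) = walkWeight w p + walkWeight w q := by
  simp [walkWeight]

@[simp] lemma walkWeight_reverse (p : G.Walk u v) :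
    walkWeight w p.reverse = walkWeight w p := by
  simp [walkWeight, List.sum_reverse]

@[simp] lemma walkWeight_transfer (p : G.Walk u v) (h : ∀ e ∈ p.edges, e ∈ H.edgeSet) :
    walkWeight w (p.transfer H h) = walkWeight w p := by
  simp [walkWeight]

@[simp] lemma walkWeight_mapLe (hGH : G ≤ H) (p : G.Walk u v) :
    walkWeight w (p.mapLe hGH) = walkWeight w p := by
  simp [walkWeight]

lemma walkWeight_nonneg (hw : ∀ e ∈ G.edgeSet, 0 ≤ w e) (p : G.Walk u v) :
    0 ≤ walkWeight w p := by
  refine List.sum_nonneg fun r hr => ?_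
  obtain ⟨e, he, rfl⟩ := List.mem_map.mp hr
  exact hw e (p.edges_subset_edgeSet he)

lemma le_walkWeight_of_mem_edges (hw : ∀ e ∈ G.edgeSet, 0 ≤ w e) {p : G.Walk u v} {e : Sym2 V}
    (he : e ∈ p.edges) : w e ≤ walkWeight w p := by
  refine List.single_le_sum (fun r hr => ?_) _ (List.mem_map_of_mem he)
  obtain ⟨f, hf, rfl⟩ := List.mem_map.mp hr
  exact hw f (p.edges_subset_edgeSet hf)

lemma walkWeight_bypass_le (hw : ∀ e ∈ G.edgeSet, 0 ≤ w e) (p : G.Walk u v) :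
    walkWeight w p.bypass ≤ walkWeight w p := by
  refine (p.edges_bypass_sublist_edges.map w).sum_le_sum fun r hr => ?_
  obtain ⟨e, he, rfl⟩ := List.mem_map.mp hr
  exact hw e (p.edges_subset_edgeSet he)

lemma wWeight_eq_sum [Fintype V] (F : Finset (Sym2 V)) (hF : (F : Set (Sym2 V)) = G.edgeSet) :
    wWeight G w = ∑ e ∈ F, w e := by
  refine Finset.sum_congr (Finset.ext fun e => ?_) fun _ _ => rfl
  rw [Set.Finite.mem_toFinset, ← hF, Finset.mem_coe]

lemma walkWeight_le_wWeight_of_isPath [Fintype V] (hw : ∀ e ∈ G.edgeSet, 0 ≤ w e)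
    {p : G.Walk u v} (hp : p.IsPath) : walkWeight w p ≤ wWeight G w := by
  rw [walkWeight, ← List.sum_toFinset w hp.isTrail.edges_nodup, wWeight]
  refine Finset.sum_le_sum_of_subset_of_nonneg (fun e he => ?_) fun e he _ => ?_
  · simpa using p.edges_subset_edgeSet (List.mem_toFinset.mp he)
  · exact hw e (by simpa using he)

lemma wdist_le (hw : ∀ e ∈ G.edgeSet, 0 ≤ w e) (p : G.Walk u v) :
    wdist G w u v ≤ walkWeight w p :=
  csInf_le ⟨0, by rintro _ ⟨q, rfl⟩; exact walkWeight_nonneg hw q⟩ ⟨p, rfl⟩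

lemma exists_isPath_walkWeight_eq_wdist [Fintype V] (hG : G.Connected)
    (hw : ∀ e ∈ G.edgeSet, 0 ≤ w e) (u v : V) :
    ∃ p : G.Walk u v, p.IsPath ∧ walkWeight w p = wdist G w u v := by
  have : Nonempty (G.Path u v) := (hG u v).elim fun p => ⟨⟨p.bypass, p.bypass_isPath⟩⟩
  obtain ⟨p, hp⟩ := Finite.exists_min fun p : G.Path u v => walkWeight w p.1
  refine ⟨p.1, p.2, le_antisymm ?_ (wdist_le hw p.1)⟩
  refine le_csInf ⟨_, p.1, rfl⟩ ?_
  rintro _ ⟨q, rfl⟩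
  exact (hp ⟨q.bypass, q.bypass_isPath⟩).trans (walkWeight_bypass_le hw q)

lemma wdist_nonneg [Fintype V] (hG : G.Connected) (hw : ∀ e ∈ G.edgeSet, 0 ≤ w e) (u v : V) :
    0 ≤ wdist G w u v := by
  obtain ⟨p, -, hp⟩ := exists_isPath_walkWeight_eq_wdist hG hw u v
  exact hp ▸ walkWeight_nonneg hw p

lemma wdist_self [Fintype V] (hG : G.Connected) (hw : ∀ e ∈ G.edgeSet, 0 ≤ w e) (u : V) :
    wdist G w u u = 0 :=
  le_antisymm ((wdist_le hw SimpleGraph.Walk.nil).trans_eq walkWeight_nil) (wdist_nonneg hG hw u u)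

lemma wdist_comm [Fintype V] (hG : G.Connected) (hw : ∀ e ∈ G.edgeSet, 0 ≤ w e) (u v : V) :
    wdist G w u v = wdist G w v u := by
  have key : ∀ x y, wdist G w x y ≤ wdist G w y x := fun x y => by
    obtain ⟨p, -, hp⟩ := exists_isPath_walkWeight_eq_wdist hG hw y x
    simpa [hp] using wdist_le hw p.reverse
  exact le_antisymm (key u v) (key v u)

lemma wdist_triangle [Fintype V] (hG : G.Connected) (hw : ∀ e ∈ G.edgeSet, 0 ≤ w e)
    (u v x : V) : wdist G w u x ≤ wdist G w u v + wdist G w v x := by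
  obtain ⟨p, -, hp⟩ := exists_isPath_walkWeight_eq_wdist hG hw u v
  obtain ⟨q, -, hq⟩ := exists_isPath_walkWeight_eq_wdist hG hw v x
  simpa [hp, hq] using wdist_le hw (p.append q)

lemma wdist_le_of_adj (hw : ∀ e ∈ G.edgeSet, 0 ≤ w e) (h : G.Adj u v) :
    wdist G w u v ≤ w s(u, v) := by
  simpa using wdist_le hw h.toWalk

lemma wdist_pos_of_ne [Fintype V] (hG : G.Connected) (hw : ∀ e ∈ G.edgeSet, 0 < w e)
    (huv : u ≠ v) : 0 < wdist G w u v := by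
  obtain ⟨p, -, hp⟩ := exists_isPath_walkWeight_eq_wdist hG (fun e he => (hw e he).le) u v
  rw [← hp]
  cases p with
  | nil => exact absurd rfl huv
  | cons h q =>
    rw [walkWeight_cons]
    have := walkWeight_nonneg (fun e he => (hw e he).le) q
    linarith [hw _ (SimpleGraph.mem_edgeSet G |>.mpr h)]

/-- A path through an edge splits at that edge into two walks avoiding it. -/
lemma exists_walks_of_mem_edges {e : Sym2 V} (p : G.Walk x y) (hp : p.IsPath)
    (he : e ∈ p.edges) :
    ∃ (a b : V) (p₁ : G.Walk x a) (p₂ : G.Walk b y), s(a, b) = e ∧ e ∉ p₁.edges ∧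
      e ∉ p₂.edges ∧ walkWeight w p = walkWeight w p₁ + w e + walkWeight w p₂ := by
  suffices h : ∃ (a b : V) (p₁ : G.Walk x a) (p₂ : G.Walk b y), s(a, b) = e ∧
      p.edges = p₁.edges ++ e :: p₂.edges by
    obtain ⟨a, b, p₁, p₂, hab, hedges⟩ := h
    have hnd := hp.isTrail.edges_nodup
    rw [hedges] at hnd
    refine ⟨a, b, p₁, p₂, hab, ?_, ?_, ?_⟩
    · exact fun h => (List.nodup_append.mp hnd).2.2 _ h _ List.mem_cons_self rfl
    · exact (List.nodup_cons.mp (List.nodup_append.mp hnd).2.1).1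
    · simp [walkWeight, hedges, add_assoc]
  clear hp
  induction p with
  | nil => simp at he
  | @cons i j k hij q ih =>
    by_cases hq : s(i, j) = e
    · exact ⟨i, j, .nil, q, hq, by simp [hq]⟩
    · obtain ⟨a, b, p₁, p₂, hab, hedges⟩ := ih (by simpa [Ne.symm hq] using he)
      exact ⟨a, b, .cons hij p₁, p₂, hab, by simp [hedges]⟩

end WalkWeight

/-- A pseudometric, written as a function on unordered pairs. -/
structure IsSymPseudometric {V : Type*} (d : Sym2 V → ℝ) : Prop where
  nonneg : ∀ e, 0 ≤ d e
  self : ∀ x, d s(x, x) = 0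
  triangle : ∀ x y z, d s(x, z) ≤ d s(x, y) + d s(y, z)

lemma IsSymPseudometric.le_walkWeight {V : Type*} {G : SimpleGraph V} {d : Sym2 V → ℝ}
    (hd : IsSymPseudometric d) {u v : V} (p : G.Walk u v) : d s(u, v) ≤ walkWeight d p := by
  induction p with
  | nil => simp [hd.self]
  | @cons i j k h q ih =>
    rw [walkWeight_cons]
    linarith [hd.triangle i j k]

/-- Every edge of `F` is much shorter than any detour around it in the graph `T ∪ F`. -/
def HasLongDetours {V : Type*} (T : SimpleGraph V) (F : Finset (Sym2 V)) (d : Sym2 V → ℝ)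
    (t : ℝ) : Prop :=
  ∀ a b, s(a, b) ∈ F → ∀ p : (T ⊔ SimpleGraph.fromEdgeSet (F : Set (Sym2 V))).Walk a b,
    s(a, b) ∉ p.edges → t * d s(a, b) < walkWeight d p

section Spanner

variable {V : Type*} {T : SimpleGraph V} {d : Sym2 V → ℝ} {t : ℝ}

lemma HasLongDetours.insert_edge {F : Finset (Sym2 V)} (hd : IsSymPseudometric d) (ht : 0 ≤ t)
    (hF : HasLongDetours T F d t) {a b : V} (hmax : ∀ e ∈ F, d e ≤ d s(a, b))
    (hlong : ∀ p : (T ⊔ SimpleGraph.fromEdgeSet (F : Set (Sym2 V))).Walk a b,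
      t * d s(a, b) < walkWeight d p) :
    HasLongDetours T (insert s(a, b) F) d t := by
  set A := T ⊔ SimpleGraph.fromEdgeSet (F : Set (Sym2 V)) with hA
  set A' := T ⊔ SimpleGraph.fromEdgeSet ((insert s(a, b) F : Finset _) : Set (Sym2 V)) with hA'
  have hlong' : ∀ (x y : V) (p : A.Walk x y), s(x, y) = s(a, b) →
      t * d s(a, b) < walkWeight d p := by
    intro x y p hxy
    rcases Sym2.eq_iff.mp hxy with ⟨rfl, rfl⟩ | ⟨rfl, rfl⟩
    · exact hlong p
    · simpa using hlong p.reverse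
  have hsub : ∀ e ∈ A'.edgeSet, e ≠ s(a, b) → e ∈ A.edgeSet := by
    intro e he hne
    simp only [hA, hA', SimpleGraph.edgeSet_sup, SimpleGraph.edgeSet_fromEdgeSet, Set.mem_union,
      Set.mem_sdiff, Finset.mem_coe, Finset.mem_insert] at he ⊢
    tauto
  have htransfer : ∀ {x y : V} (p : A'.Walk x y), s(a, b) ∉ p.edges →
      ∀ e ∈ p.edges, e ∈ A.edgeSet := fun p hp e he =>
    hsub e (p.edges_subset_edgeSet he) fun h => hp (h ▸ he)
  intro x y hxy p hp
  by_cases hab : s(x, y) = s(a, b)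
  · rw [hab] at hp ⊢
    simpa using hlong' x y (p.transfer A (htransfer p hp)) hab
  have hxyF : s(x, y) ∈ F := (Finset.mem_insert.mp hxy).resolve_left hab
  have hw : ∀ e ∈ A'.edgeSet, 0 ≤ d e := fun e _ => hd.nonneg e
  refine lt_of_lt_of_le ?_ (walkWeight_bypass_le hw p)
  have hq : s(x, y) ∉ p.bypass.edges := fun h => hp (p.edges_bypass_subset_edges h)
  have hqpath := p.bypass_isPath
  generalize p.bypass = q at hq hqpath
  by_cases hqab : s(a, b) ∈ q.edges
  · obtain ⟨a', b', q₁, q₂, hab', h₁, h₂, hsum⟩ :=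
      exists_walks_of_mem_edges (w := d) q hqpath hqab
    have hadj : A.Adj x y := by
      refine Or.inr ((SimpleGraph.fromEdgeSet_adj _).mpr ⟨hxyF, ?_⟩)
      rintro rfl
      have := hF x x hxyF .nil (by simp)
      rw [walkWeight_nil, hd.self, mul_zero] at this
      exact lt_irrefl _ this
    have := hlong' a' b' (((q₁.transfer A (htransfer q₁ h₁)).reverse.append hadj.toWalk).append
      (q₂.transfer A (htransfer q₂ h₂)).reverse) hab'
    simp only [walkWeight_append, walkWeight_reverse, walkWeight_transfer, walkWeight_cons,
      SimpleGraph.Adj.toWalk, walkWeight_nil] at this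
    have hle := hmax _ hxyF
    have := mul_le_mul_of_nonneg_left hle ht
    linarith
  · rw [← walkWeight_transfer q (htransfer q hqab)]
    exact hF x y hxyF (q.transfer A (htransfer q hqab)) (by rwa [SimpleGraph.Walk.edges_transfer])

/-- The greedy spanner: processing pairs by increasing length gives a spanner all of whose
edges have long detours. -/
lemma exists_greedy_spanner (hd : IsSymPseudometric d) (ht : 1 ≤ t)
    (S : Finset (Sym2 V)) :
    ∃ F ⊆ S, HasLongDetours T F d t ∧ (∀ e ∈ F, e ∉ T.edgeSet ∧ ¬ e.IsDiag) ∧ ∀ a b, s(a, b) ∈ S →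
      ∃ p : (T ⊔ SimpleGraph.fromEdgeSet (F : Set (Sym2 V))).Walk a b,
        walkWeight d p ≤ t * d s(a, b) := by
  induction S using Finset.induction_on_max_value d with
  | empty => exact ⟨∅, subset_rfl, by simp [HasLongDetours], by simp, by simp⟩
  | insert e S he hmax ih =>
    obtain ⟨F, hFS, hF, hnew, hspan⟩ := ih
    by_cases hcase : ∀ a b, s(a, b) = e →
        ∃ p : (T ⊔ SimpleGraph.fromEdgeSet (F : Set (Sym2 V))).Walk a b,
          walkWeight d p ≤ t * d s(a, b)
    · refine ⟨F, hFS.trans (Finset.subset_insert _ _), hF, hnew, fun a b hab => ?_⟩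
      exact (Finset.mem_insert.mp hab).elim (hcase a b) (hspan a b)
    · push Not at hcase
      obtain ⟨a, b, rfl, hlong⟩ := hcase
      have hne : a ≠ b := by
        rintro rfl
        simpa [hd.self] using hlong .nil
      have hmono : T ⊔ SimpleGraph.fromEdgeSet (F : Set (Sym2 V)) ≤
          T ⊔ SimpleGraph.fromEdgeSet ((insert s(a, b) F : Finset _) : Set (Sym2 V)) :=
        sup_le_sup_left (SimpleGraph.fromEdgeSet_mono (by simp)) _
      refine ⟨insert s(a, b) F, Finset.insert_subset_insert _ hFS,
        hF.insert_edge hd (by linarith) (fun e he => hmax e (hFS he)) hlong, ?_, fun x y hxy => ?_⟩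
      · intro e he
        rcases Finset.mem_insert.mp he with rfl | he
        · refine ⟨fun hT => ?_, by simpa using hne⟩
          have hadj : (T ⊔ SimpleGraph.fromEdgeSet (F : Set (Sym2 V))).Adj a b := Or.inl hT
          have := hlong hadj.toWalk
          simp only [SimpleGraph.Adj.toWalk, walkWeight_cons, walkWeight_nil, add_zero] at this
          exact absurd this (le_mul_of_one_le_left (hd.nonneg _) ht).not_gt
        · exact hnew e he
      rcases Finset.mem_insert.mp hxy with hxy | hxy
      · have hxyne : x ≠ y := by
          rintro rfl
          exact hne (Sym2.mk_isDiag_iff.mp (hxy ▸ Sym2.mk_isDiag_iff.mpr rfl))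
        have hadj : (T ⊔ SimpleGraph.fromEdgeSet
            ((insert s(a, b) F : Finset _) : Set (Sym2 V))).Adj x y :=
          Or.inr ((SimpleGraph.fromEdgeSet_adj _).mpr ⟨by simp [hxy], hxyne⟩)
        refine ⟨hadj.toWalk, ?_⟩
        simpa [SimpleGraph.Adj.toWalk] using le_mul_of_one_le_left (hd.nonneg _) ht
      · obtain ⟨p, hp⟩ := hspan x y hxy
        exact ⟨p.mapLe hmono, by simpa using hp⟩

end Spanner

section Clusters

variable {V : Type*} {T : SimpleGraph V} {F : Finset (Sym2 V)} {d : Sym2 V → ℝ} {t R : ℝ}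

/-- Inside a cluster of radius `R`, an edge with long detours cannot be bypassed. -/
lemma HasLongDetours.mem_edges_of_cluster (hd : IsSymPseudometric d) (hF : HasLongDetours T F d t)
    {Q : SimpleGraph V} (hQ : Q ≤ T ⊔ SimpleGraph.fromEdgeSet (F : Set (Sym2 V)))
    {u a b : V} (hab : s(a, b) ∈ F) (hR : 5 * R ≤ t * d s(a, b)) (q : Q.Walk a b)
    (hball : ∀ y ∈ q.support,
      ∃ p : (T ⊔ SimpleGraph.fromEdgeSet (F : Set (Sym2 V))).Walk u y, walkWeight d p ≤ R) :
    s(a, b) ∈ q.edges := by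
  set A := T ⊔ SimpleGraph.fromEdgeSet (F : Set (Sym2 V)) with hA
  have hw : ∀ e ∈ A.edgeSet, 0 ≤ d e := fun e _ => hd.nonneg e
  -- it suffices to treat the endpoint that is reached from the centre without using the edge
  suffices key : ∀ {a b : V}, s(a, b) ∈ F → 5 * R ≤ t * d s(a, b) → ∀ q : Q.Walk a b,
      (∀ y ∈ q.support, ∃ p : A.Walk u y, walkWeight d p ≤ R) →
      (∃ p : A.Walk u a, s(a, b) ∉ p.edges ∧ walkWeight d p ≤ R) → s(a, b) ∈ q.edges by
    obtain ⟨p, hp⟩ := hball a q.start_mem_support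
    have hp' := (walkWeight_bypass_le hw p).trans hp
    by_cases hpe : s(a, b) ∈ p.bypass.edges
    · obtain ⟨a', b', p₁, p₂, hab', h₁, -, hsum⟩ :=
        exists_walks_of_mem_edges (w := d) _ p.bypass_isPath hpe
      have hle : walkWeight d p₁ ≤ R := by
        linarith [walkWeight_nonneg hw p₂, hd.nonneg s(a, b)]
      rcases Sym2.eq_iff.mp hab' with ⟨rfl, rfl⟩ | ⟨rfl, rfl⟩
      · exact key hab hR q hball ⟨p₁, h₁, hle⟩
      · rw [Sym2.eq_swap] at hab hR h₁ ⊢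
        simpa using key hab hR q.reverse (by simpa using hball) ⟨p₁, h₁, hle⟩
    · exact key hab hR q hball ⟨_, hpe, hp'⟩
  clear hball hR hab q a b
  rintro a b hab hR q hball ⟨pa, hpa, hpaR⟩
  have hR0 : 0 ≤ R := (walkWeight_nonneg hw pa).trans hpaR
  by_contra hq
  have hshort : ∀ p : A.Walk a b, s(a, b) ∉ p.edges → ¬ walkWeight d p ≤ 5 * R :=
    fun p hp h => absurd (hF a b hab p hp) (by linarith)
  have hnear : ∀ y ∈ q.support, (∃ p : A.Walk u y, s(a, b) ∉ p.edges ∧ walkWeight d p ≤ R) ∨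
      ∃ p : A.Walk b y, s(a, b) ∉ p.edges ∧ walkWeight d p ≤ R := by
    intro y hy
    obtain ⟨p, hp⟩ := hball y hy
    have hp' := (walkWeight_bypass_le hw p).trans hp
    by_cases hpe : s(a, b) ∈ p.bypass.edges
    · obtain ⟨a', b', p₁, p₂, hab', h₁, h₂, hsum⟩ :=
        exists_walks_of_mem_edges (w := d) _ p.bypass_isPath hpe
      have h₁R : walkWeight d p₁ ≤ R := by
        linarith [walkWeight_nonneg hw p₂, hd.nonneg s(a, b)]
      have h₂R : walkWeight d p₂ ≤ R := by
        linarith [walkWeight_nonneg hw p₁, hd.nonneg s(a, b)]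
      rcases Sym2.eq_iff.mp hab' with ⟨rfl, rfl⟩ | ⟨rfl, rfl⟩
      · exact Or.inr ⟨p₂, h₂, h₂R⟩
      · refine absurd ?_ (hshort (pa.reverse.append p₁) (by simp [hpa, h₁]))
        simp only [walkWeight_append, walkWeight_reverse]
        linarith
    · exact Or.inl ⟨_, hpe, hp'⟩
  have hdist : ∀ {x y : V}, x ∈ q.support → y ∈ q.support → d s(x, y) ≤ 2 * R := by
    intro x y hx hy
    obtain ⟨p, hp⟩ := hball x hx
    obtain ⟨p', hp'⟩ := hball y hy
    have := hd.le_walkWeight (p.reverse.append p')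
    rw [walkWeight_append, walkWeight_reverse] at this
    linarith
  have hwalk : ∀ {x y : V} (r : Q.Walk x y), r.support ⊆ q.support → s(a, b) ∉ r.edges →
      (∃ p : A.Walk u x, s(a, b) ∉ p.edges ∧ walkWeight d p ≤ R) →
      ∃ p : A.Walk u y, s(a, b) ∉ p.edges ∧ walkWeight d p ≤ R := by
    intro x y r
    induction r with
    | nil => exact fun _ _ h => h
    | @cons x y z hxy r ih =>
      rintro hsupp hr ⟨p, hp, hpR⟩
      rw [SimpleGraph.Walk.support_cons, List.cons_subset] at hsupp
      rw [SimpleGraph.Walk.edges_cons, List.mem_cons, not_or] at hr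
      have hy := hsupp.2 r.start_mem_support
      refine ih hsupp.2 hr.2 ((hnear y hy).resolve_right ?_)
      rintro ⟨p', hp', hpR'⟩
      refine hshort (((pa.reverse.append p).append (hQ hxy).toWalk).append p'.reverse) ?_ ?_
      · simp [hpa, hp, hp', hr.1, SimpleGraph.Adj.toWalk]
      · simp only [walkWeight_append, walkWeight_reverse, SimpleGraph.Adj.toWalk,
          walkWeight_cons, walkWeight_nil]
        linarith [hdist hsupp.1 hy]
  obtain ⟨p, hp, hpR⟩ := hwalk q (List.Subset.refl _) hq ⟨pa, hpa, hpaR⟩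
  refine hshort (pa.reverse.append p) (by simp [hpa, hp]) ?_
  rw [walkWeight_append, walkWeight_reverse]
  linarith

/-- An edge is cut by a clustering if its endpoints lie in different clusters. -/
def IsCutBy {β : Type*} (c : V → β) (e : Sym2 V) : Prop := ¬ (Sym2.map c e).IsDiag

lemma HasLongDetours.card_le_card_cut [Fintype V] (hd : IsSymPseudometric d)
    (hF : HasLongDetours T F d t) (hT : T.IsTree) (hdisj : ∀ e ∈ F, e ∉ T.edgeSet)
    (hdiag : ∀ e ∈ F, ¬ e.IsDiag) (c : V → Option V)
    (hc : ∀ x u, c x = some u →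
      ∃ p : (T ⊔ SimpleGraph.fromEdgeSet (F : Set (Sym2 V))).Walk u x, walkWeight d p ≤ R)
    {F' : Finset (Sym2 V)} (hF' : F' ⊆ F) (hR : ∀ e ∈ F', 5 * R ≤ t * d e)
    (hsome : ∀ e ∈ F', ∀ x ∈ e, c x ≠ none) :
    F'.card ≤ ((T.edgeFinset ∪ F').filter (IsCutBy c)).card := by
  set E := (T.edgeFinset ∪ F').filter fun e => ¬ IsCutBy c e with hE
  set Q := SimpleGraph.fromEdgeSet (E : Set (Sym2 V)) with hQdef
  have hQadj : ∀ {x y}, Q.Adj x y → (T.Adj x y ∨ s(x, y) ∈ F') ∧ c x = c y := by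
    intro x y h
    have := (SimpleGraph.fromEdgeSet_adj _).mp h
    simpa [hE, IsCutBy] using this.1
  have hQ : Q ≤ T ⊔ SimpleGraph.fromEdgeSet (F : Set (Sym2 V)) := fun x y h =>
    (hQadj h).1.imp id fun h' => (SimpleGraph.fromEdgeSet_adj _).mpr ⟨hF' h', h.ne⟩
  have hconst : ∀ {x y : V} (q : Q.Walk x y), ∀ z ∈ q.support, c z = c x := by
    intro x y q
    induction q with
    | nil => simp
    | cons h q ih =>
      intro z hz
      rw [SimpleGraph.Walk.support_cons, List.mem_cons] at hz
      rcases hz with rfl | hz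
      · rfl
      · rw [ih z hz, (hQadj h).2]
  have hbridge : ∀ e ∈ F', ∀ (v : V) (z : Q.Walk v v), z.IsCycle → e ∉ z.edges := by
    intro e he v z hz hez
    induction e with | h a b =>
    have hreach : (Q.deleteEdges {s(a, b)}).Reachable a b :=
      (SimpleGraph.adj_and_reachable_delete_edges_iff_exists_cycle.mpr
        ⟨v, z, hz, hez⟩).2
    rw [SimpleGraph.reachable_deleteEdges_iff_exists_walk] at hreach
    obtain ⟨q, hq⟩ := hreach
    obtain ⟨u, hu⟩ := Option.ne_none_iff_exists'.mp (hsome _ he a (Sym2.mem_mk_left a b))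
    exact hq (hF.mem_edges_of_cluster hd hQ (hF' he) (hR _ he) q fun y hy =>
      hc y u ((hconst q y hy).trans hu))
  have hacyc : Q.IsAcyclic := by
    intro v z hz
    have hzT : ∀ e ∈ z.edges, e ∈ T.edgeSet := by
      intro e he
      have hnot : e ∉ F' := fun h => hbridge e h v z hz he
      have heQ := z.edges_subset_edgeSet he
      induction e with | h a b => exact (hQadj heQ).1.resolve_right hnot
    exact hT.2 (z.transfer T hzT) (hz.transfer hzT)
  have hEcard : E.card ≤ T.edgeFinset.card := by
    have := hT.1.nonempty
    obtain ⟨T', hQT', -, hT'⟩ :=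
      SimpleGraph.connected_top.exists_isTree_le_of_le_of_isAcyclic (le_top : Q ≤ ⊤) hacyc
    have hcard := hT.card_edgeFinset.trans hT'.card_edgeFinset.symm
    rw [Nat.add_right_cancel hcard]
    refine Finset.card_le_card fun e he => ?_
    rw [SimpleGraph.mem_edgeFinset]
    refine SimpleGraph.edgeSet_mono hQT' ?_
    rw [hQdef, SimpleGraph.edgeSet_fromEdgeSet]
    refine ⟨he, fun hde => ?_⟩
    rcases Finset.mem_union.mp (Finset.mem_filter.mp he).1 with h | h
    · exact T.not_isDiag_of_mem_edgeFinset h hde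
    · exact hdiag _ (hF' h) hde
  have hsplit : ((T.edgeFinset ∪ F').filter (IsCutBy c)).card + E.card =
      (T.edgeFinset ∪ F').card := by
    rw [hE]
    convert Finset.card_filter_add_card_filter_not (s := T.edgeFinset ∪ F') (IsCutBy c)
  rw [Finset.card_union_of_disjoint] at hsplit
  · omega
  · exact Finset.disjoint_left.mpr fun e he he' =>
      hdisj e (hF' he') (SimpleGraph.mem_edgeFinset.mp he)

end Clusters

section Averaging

/-- In a uniformly random ordering, each element of `S` is the first one of `S` with
probability `1 / |S|`. -/
lemma card_filter_forall_le {V : Type*} [Fintype V] {n : ℕ} (S : Finset V) {u : V} (hu : u ∈ S) :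
    ((Finset.univ.filter fun σ : V ≃ Fin n => ∀ v ∈ S, σ u ≤ σ v).card : ℝ) =
      Fintype.card (V ≃ Fin n) / S.card := by
  set N : V → ℕ := fun u =>
    (Finset.univ.filter fun σ : V ≃ Fin n => ∀ v ∈ S, σ u ≤ σ v).card with hN
  have hle : ∀ x ∈ S, ∀ y ∈ S, N x ≤ N y := by
    intro x hx y hy
    refine Finset.card_le_card_of_injOn (fun σ => (Equiv.swap x y).trans σ) ?_ ?_
    · intro σ hσ
      simp only [Finset.coe_filter, Finset.mem_univ, true_and, Set.mem_ofPred_eq,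
        Equiv.trans_apply, Equiv.swap_apply_right] at hσ ⊢
      intro v hv
      refine hσ _ ?_
      rcases eq_or_ne v x with rfl | hvx
      · rwa [Equiv.swap_apply_left]
      rcases eq_or_ne v y with rfl | hvy
      · rwa [Equiv.swap_apply_right]
      · rwa [Equiv.swap_apply_of_ne_of_ne hvx hvy]
    · intro σ _ τ _ h
      ext v
      have := congrArg (fun e : V ≃ Fin n => e (Equiv.swap x y v)) h
      simpa using congrArg Fin.val this
  have hsum : ∑ v ∈ S, N v = Fintype.card (V ≃ Fin n) := by
    simp only [hN, Finset.card_filter]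
    rw [Finset.sum_comm, ← Finset.card_univ, Finset.card_eq_sum_ones]
    refine Finset.sum_congr rfl fun σ _ => ?_
    obtain ⟨m, hm, hmin⟩ := S.exists_min_image σ ⟨u, hu⟩
    rw [Finset.sum_eq_single_of_mem m hm, if_pos hmin]
    intro v hv hvm
    exact if_neg fun h => hvm (σ.injective (le_antisymm (h m hm) (hmin v hv)))
  have hcard : Fintype.card (V ≃ Fin n) = S.card * N u := by
    rw [← hsum, Finset.sum_congr rfl fun v hv => le_antisymm (hle v hv u hu) (hle u hu v hv),
      Finset.sum_const, smul_eq_mul]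
  have hS : (S.card : ℝ) ≠ 0 := by exact_mod_cast (Finset.card_pos.mpr ⟨u, hu⟩).ne'
  rw [hcard]
  push_cast
  rw [mul_div_cancel_left₀ _ hS]

lemma sum_one_div_card_le_harmonic {ι : Type*} (S : Finset ι) (f : ι → ℝ) :
    ∑ u ∈ S, (1 : ℝ) / (S.filter fun v => f v ≤ f u).card ≤ harmonic S.card := by
  induction S using Finset.induction_on_max_value f with
  | empty => simp
  | insert a S ha hmax ih =>
    rw [Finset.sum_insert ha, Finset.card_insert_of_notMem ha, harmonic_succ]
    push_cast
    have hall : (insert a S).filter (fun v => f v ≤ f a) = insert a S :=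
      Finset.filter_true_of_mem fun v hv => by
        rcases Finset.mem_insert.mp hv with rfl | hv
        exacts [le_rfl, hmax v hv]
    rw [hall, Finset.card_insert_of_notMem ha, add_comm]
    refine add_le_add ((Finset.sum_le_sum fun u hu => ?_).trans ih) (by simp)
    refine one_div_le_one_div_of_le ?_ ?_
    · exact_mod_cast Finset.card_pos.mpr ⟨u, by simp [hu]⟩
    · exact_mod_cast Finset.card_le_card (Finset.filter_subset_filter _ (Finset.subset_insert _ _))

lemma integrable_ite_Ico (a x y : ℝ) :
    MeasureTheory.Integrable fun R : ℝ => if x ≤ R ∧ R < y then a else 0 := by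
  have h : (fun R : ℝ => if x ≤ R ∧ R < y then a else 0) = (Set.Ico x y).indicator fun _ => a := by
    ext R
    simp [Set.indicator_apply]
  rw [h, MeasureTheory.integrable_indicator_iff measurableSet_Ico]
  exact MeasureTheory.integrableOn_const (by simp)

lemma integral_ite_Ico (a : ℝ) {x y : ℝ} (hxy : x ≤ y) :
    ∫ R : ℝ, (if x ≤ R ∧ R < y then a else 0) = a * (y - x) := by
  have h : (fun R : ℝ => if x ≤ R ∧ R < y then a else 0) = (Set.Ico x y).indicator fun _ => a := by
    ext R
    simp [Set.indicator_apply]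
  rw [h, MeasureTheory.integral_indicator measurableSet_Ico, MeasureTheory.setIntegral_const,
    Real.volume_real_Ico_of_le hxy, smul_eq_mul, mul_comm]

/-- Integrating a pointwise inequality between two step functions. -/
lemma sum_mul_sub_le_of_step_le {ι κ : Type*} (s : Finset ι) (s' : Finset κ) (a x y : ι → ℝ)
    (b p q : κ → ℝ) (hxy : ∀ i ∈ s, x i ≤ y i) (hpq : ∀ j ∈ s', p j ≤ q j)
    (h : ∀ R : ℝ, ∑ i ∈ s, (if x i ≤ R ∧ R < y i then a i else 0) ≤
      ∑ j ∈ s', (if p j ≤ R ∧ R < q j then b j else 0)) :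
    ∑ i ∈ s, a i * (y i - x i) ≤ ∑ j ∈ s', b j * (q j - p j) := by
  have hint := MeasureTheory.integral_mono
    (MeasureTheory.integrable_finsetSum s fun i _ => integrable_ite_Ico (a i) (x i) (y i))
    (MeasureTheory.integrable_finsetSum s' fun j _ => integrable_ite_Ico (b j) (p j) (q j)) h
  rw [MeasureTheory.integral_finsetSum _ fun i _ => integrable_ite_Ico _ _ _,
    MeasureTheory.integral_finsetSum _ fun j _ => integrable_ite_Ico _ _ _,
    Finset.sum_congr rfl fun i hi => integral_ite_Ico (a i) (hxy i hi),
    Finset.sum_congr rfl fun j hj => integral_ite_Ico (b j) (hpq j hj)] at hint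
  exact hint

end Averaging

section Lightness

variable {V : Type*}

/-- Each point joins the first centre of `K`, in the order `σ`, within distance `R` of it. -/
lemma exists_clustering {n : ℕ} (K : Finset V) (D : V → V → ℝ) (R : ℝ) (σ : V ≃ Fin n) :
    ∃ c : V → Option V, ∀ x u, c x = some u ↔
      u ∈ K ∧ D u x ≤ R ∧ ∀ v ∈ K, D v x ≤ R → σ u ≤ σ v := by
  refine ⟨fun x => if h : ∃ u, u ∈ K ∧ D u x ≤ R ∧ ∀ v ∈ K, D v x ≤ R → σ u ≤ σ v then
    some h.choose else none, fun x u => ?_⟩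
  dsimp only
  split_ifs with h
  · have hs := h.choose_spec
    rw [Option.some_inj]
    refine ⟨fun hu => hu ▸ hs, fun hu => σ.injective (le_antisymm ?_ ?_)⟩
    · exact hs.2.2 u hu.1 hu.2.1
    · exact hu.2.2 _ hs.1 hs.2.1
  · exact ⟨fun hu => by simp at hu, fun hu => absurd ⟨u, hu⟩ h⟩

lemma exists_first_of_isCutBy {n : ℕ} {K : Finset V} {D : V → V → ℝ} {R : ℝ} {σ : V ≃ Fin n}
    {c : V → Option V} (hc : ∀ x u, c x = some u ↔
      u ∈ K ∧ D u x ≤ R ∧ ∀ v ∈ K, D v x ≤ R → σ u ≤ σ v) {e : Sym2 V} (he : IsCutBy c e) :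
    ∃ u ∈ K, ((e.map (D u)).inf ≤ R ∧ R < (e.map (D u)).sup) ∧
      ∀ v ∈ K, (e.map (D v)).inf ≤ R → σ u ≤ σ v := by
  induction e with | h x y =>
  simp only [IsCutBy, Sym2.map_mk, Sym2.mk_isDiag_iff, Sym2.inf_mk, Sym2.sup_mk] at he ⊢
  have hne : (K.filter fun u => D u x ⊓ D u y ≤ R).Nonempty := by
    by_contra hempty
    have hfar := Finset.filter_eq_empty_iff.mp (Finset.not_nonempty_iff_eq_empty.mp hempty)
    have hnone : ∀ z, (∀ u ∈ K, ¬ D u z ≤ R) → c z = none := fun z hz =>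
      Option.eq_none_iff_forall_ne_some.mpr fun u hu =>
        hz u ((hc z u).mp hu).1 ((hc z u).mp hu).2.1
    refine he ((hnone x fun u hu h => hfar hu ?_).trans (hnone y fun u hu h => hfar hu ?_).symm)
    exacts [inf_le_left.trans h, inf_le_right.trans h]
  obtain ⟨u, hu, hmin⟩ := Finset.exists_min_image _ σ hne
  obtain ⟨huK, huR⟩ := Finset.mem_filter.mp hu
  have hmin' : ∀ v ∈ K, D v x ⊓ D v y ≤ R → σ u ≤ σ v := fun v hv h =>
    hmin v (Finset.mem_filter.mpr ⟨hv, h⟩)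
  refine ⟨u, huK, ⟨huR, ?_⟩, hmin'⟩
  by_contra hsup
  obtain ⟨hx, hy⟩ := sup_le_iff.mp (not_lt.mp hsup)
  refine he (((hc x u).mpr ⟨huK, hx, fun v hv h => hmin' v hv ?_⟩).trans
    ((hc y u).mpr ⟨huK, hy, fun v hv h => hmin' v hv ?_⟩).symm)
  exacts [inf_le_left.trans h, inf_le_right.trans h]

variable [Fintype V] {T : SimpleGraph V} {F : Finset (Sym2 V)} {d : Sym2 V → ℝ} {t R : ℝ}

/-- The number of long edges is at most the expected number of edges cut by a random clustering
of radius `R`. -/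
lemma HasLongDetours.card_le_sum (hd : IsSymPseudometric d)
    (hF : HasLongDetours T F d t) (hT : T.IsTree) (hdisj : ∀ e ∈ F, e ∉ T.edgeSet)
    (hdiag : ∀ e ∈ F, ¬ e.IsDiag) {K : Finset V} (hK : ∀ e ∈ F, ∀ x ∈ e, x ∈ K) {D : V → V → ℝ}
    (hD : D = wdist (T ⊔ SimpleGraph.fromEdgeSet (F : Set (Sym2 V))) d) (hR0 : 0 ≤ R) :
    ((F.filter fun e => R < t / 5 * d e).card : ℝ) ≤ ∑ e ∈ T.edgeFinset ∪ F, ∑ u ∈ K,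
      (if (e.map (D u)).inf ≤ R ∧ R < (e.map (D u)).sup then
        1 / ((K.filter fun v => (e.map (D v)).inf ≤ (e.map (D u)).inf).card : ℝ) else 0) := by
  set A := T ⊔ SimpleGraph.fromEdgeSet (F : Set (Sym2 V)) with hA
  have hAconn : A.Connected := hT.1.mono le_sup_left
  have hw : ∀ e ∈ A.edgeSet, 0 ≤ d e := fun e _ => hd.nonneg e
  set F' := F.filter fun e => R < t / 5 * d e with hF'
  set Ω := V ≃ Fin (Fintype.card V)
  set first : Ω → Sym2 V → V → Prop := fun σ e u =>
    ∀ v ∈ K.filter (fun v => (e.map (D v)).inf ≤ R), σ u ≤ σ v with hfirst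
  have hΩ : (0 : ℝ) < Fintype.card Ω := by
    exact_mod_cast Fintype.card_pos_iff.mpr ⟨Fintype.equivFin V⟩
  have hσ : ∀ σ : Ω, (F'.card : ℝ) ≤ ∑ e ∈ T.edgeFinset ∪ F, ∑ u ∈ K,
      (if (e.map (D u)).inf ≤ R ∧ R < (e.map (D u)).sup then
        (if first σ e u then (1 : ℝ) else 0) else 0) := by
    intro σ
    obtain ⟨c, hc⟩ := exists_clustering K D R σ
    have hcard : F'.card ≤ ((T.edgeFinset ∪ F').filter (IsCutBy c)).card := by
      refine hF.card_le_card_cut (R := R) hd hT hdisj hdiag c ?_ (Finset.filter_subset _ _) ?_ ?_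
      · intro x u hxu
        obtain ⟨p, -, hp⟩ := exists_isPath_walkWeight_eq_wdist hAconn hw u x
        exact ⟨p, by rw [hp]; exact hD ▸ ((hc x u).mp hxu).2.1⟩
      · intro e he
        linarith [(Finset.mem_filter.mp he).2]
      · intro e he x hx hnone
        have hxK := hK e (Finset.mem_filter.mp he).1 x hx
        obtain ⟨u, hu, hmin⟩ := (K.filter fun u => D u x ≤ R).exists_min_image σ
          ⟨x, Finset.mem_filter.mpr ⟨hxK, by rw [hD, wdist_self hAconn hw]; exact hR0⟩⟩
        obtain ⟨huK, huR⟩ := Finset.mem_filter.mp hu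
        have := (hc x u).mpr ⟨huK, huR, fun v hv h => hmin v (Finset.mem_filter.mpr ⟨hv, h⟩)⟩
        simp [hnone] at this
    have hcard' : (F'.card : ℝ) ≤ ((T.edgeFinset ∪ F).filter (IsCutBy c)).card := by
      refine Nat.cast_le.mpr (hcard.trans (Finset.card_le_card ?_))
      exact Finset.filter_subset_filter _
        (Finset.union_subset_union_right (Finset.filter_subset _ _))
    refine hcard'.trans ?_
    rw [Finset.card_filter, Nat.cast_sum]
    refine Finset.sum_le_sum fun e _ => ?_
    have hnonneg : ∀ u ∈ K, (0 : ℝ) ≤ if (e.map (D u)).inf ≤ R ∧ R < (e.map (D u)).sup then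
        (if first σ e u then (1 : ℝ) else 0) else 0 := fun u _ => by positivity
    split_ifs with he
    · obtain ⟨u, huK, hu, hmin⟩ := exists_first_of_isCutBy hc he
      refine le_trans (le_of_eq ?_) (Finset.single_le_sum hnonneg huK)
      rw [if_pos hu, if_pos, Nat.cast_one]
      exact fun v hv => hmin v (Finset.mem_filter.mp hv).1 (Finset.mem_filter.mp hv).2
    · simpa using Finset.sum_nonneg hnonneg
  have hsum := Finset.sum_le_sum fun σ (_ : σ ∈ (Finset.univ : Finset Ω)) => hσ σ
  rw [Finset.sum_const, Finset.card_univ, nsmul_eq_mul, Finset.sum_comm] at hsum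
  refine le_of_mul_le_mul_left (hsum.trans ?_) hΩ
  rw [Finset.mul_sum]
  refine Finset.sum_le_sum fun e _ => ?_
  rw [Finset.sum_comm, Finset.mul_sum]
  refine Finset.sum_le_sum fun u hu => ?_
  split_ifs with hcut
  · have huN : u ∈ K.filter fun v => (e.map (D v)).inf ≤ R :=
      Finset.mem_filter.mpr ⟨hu, hcut.1⟩
    rw [Finset.sum_boole, card_filter_forall_le _ huN, div_eq_mul_one_div]
    refine mul_le_mul_of_nonneg_left (one_div_le_one_div_of_le ?_ ?_) hΩ.le
    · exact Nat.cast_pos.mpr (Finset.card_pos.mpr ⟨u, by simp [hu]⟩)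
    · refine Nat.cast_le.mpr (Finset.card_le_card fun v hv => ?_)
      rw [Finset.mem_filter] at hv ⊢
      exact ⟨hv.1, hv.2.trans hcut.1⟩
  · simp

/-- If every edge of `F` joins points of `K` and has long detours, then `F` is light. -/
lemma HasLongDetours.sum_le (hd : IsSymPseudometric d)
    (hF : HasLongDetours T F d t) (hT : T.IsTree) (hdisj : ∀ e ∈ F, e ∉ T.edgeSet)
    (hdiag : ∀ e ∈ F, ¬ e.IsDiag) {K : Finset V} (hK : ∀ e ∈ F, ∀ x ∈ e, x ∈ K) (ht0 : 0 ≤ t) :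
    t / 5 * ∑ e ∈ F, d e ≤ harmonic K.card * (wWeight T d + ∑ e ∈ F, d e) := by
  set A := T ⊔ SimpleGraph.fromEdgeSet (F : Set (Sym2 V)) with hA
  have hAconn : A.Connected := hT.1.mono le_sup_left
  have hw : ∀ e ∈ A.edgeSet, 0 ≤ d e := fun e _ => hd.nonneg e
  set D := wdist A d with hD
  set ρ : Sym2 V → V → ℝ := fun e u =>
    ((K.filter fun v => (e.map (D v)).inf ≤ (e.map (D u)).inf).card : ℝ) with hρ
  have hstep := sum_mul_sub_le_of_step_le F ((T.edgeFinset ∪ F) ×ˢ K) (fun _ => 1) (fun _ => 0)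
    (fun e => t / 5 * d e) (fun j => 1 / ρ j.1 j.2) (fun j => (j.1.map (D j.2)).inf)
    (fun j => (j.1.map (D j.2)).sup) (fun e _ => by have := hd.nonneg e; positivity)
    (fun j _ => by
      obtain ⟨e, u⟩ := j
      induction e with | h x y => simp) (fun R => by
      rw [Finset.sum_product]
      rcases le_or_gt 0 R with hR | hR
      · refine le_trans (le_of_eq ?_)
          (hF.card_le_sum hd hT hdisj hdiag hK hD hR)
        simp [hR]
      · refine le_trans (le_of_eq ?_) (Finset.sum_nonneg fun e _ => Finset.sum_nonneg fun u _ => ?_)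
        · simp [hR.not_ge]
        · positivity)
  have hleft : ∑ e ∈ F, (1 : ℝ) * (t / 5 * d e - 0) = t / 5 * ∑ e ∈ F, d e := by
    simp [Finset.mul_sum]
  rw [hleft, Finset.sum_product] at hstep
  have hwT : wWeight T d = ∑ e ∈ T.edgeFinset, d e := wWeight_eq_sum _ (by simp)
  have hunion : ∑ e ∈ T.edgeFinset ∪ F, d e = wWeight T d + ∑ e ∈ F, d e := by
    rw [hwT, Finset.sum_union]
    exact Finset.disjoint_left.mpr fun e he he' => hdisj e he' (SimpleGraph.mem_edgeFinset.mp he)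
  refine hstep.trans ?_
  rw [← hunion, Finset.mul_sum]
  refine Finset.sum_le_sum fun e he => ?_
  have heA : e ∈ A.edgeSet := by
    rw [hA, SimpleGraph.edgeSet_sup, SimpleGraph.edgeSet_fromEdgeSet]
    rcases Finset.mem_union.mp he with h | h
    · exact Or.inl (SimpleGraph.mem_edgeFinset.mp h)
    · exact Or.inr ⟨h, hdiag e h⟩
  have hlip : ∀ u, (e.map (D u)).sup - (e.map (D u)).inf ≤ d e := by
    intro u
    induction e with | h x y =>
    have hxy := wdist_le_of_adj hw heA
    have h₁ := wdist_triangle hAconn hw u x y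
    have h₂ := wdist_triangle hAconn hw u y x
    rw [wdist_comm hAconn hw y x] at h₂
    simp only [Sym2.map_mk, Sym2.sup_mk, Sym2.inf_mk]
    rw [sup_sub_inf_eq_abs_sub, abs_le]
    constructor <;> linarith
  calc ∑ u ∈ K, 1 / ρ e u * ((e.map (D u)).sup - (e.map (D u)).inf)
      ≤ ∑ u ∈ K, 1 / ρ e u * d e :=
        Finset.sum_le_sum fun u _ => mul_le_mul_of_nonneg_left (hlip u) (by positivity)
    _ = (∑ u ∈ K, 1 / ρ e u) * d e := (Finset.sum_mul _ _ _).symm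
    _ ≤ harmonic K.card * d e := mul_le_mul_of_nonneg_right
        (sum_one_div_card_le_harmonic K fun u => (e.map (D u)).inf) (hd.nonneg e)

end Lightness

section Net

variable {V : Type*}

/-- A net with radii `f`: the points of `S` have non-overlapping balls and every point is close
to a point of `S`. -/
lemma exists_separated_net [Fintype V] (D : V → V → ℝ) (f : V → ℝ) (hf : ∀ v, 0 ≤ f v)
    (hD0 : ∀ v, D v v = 0) (hDsymm : ∀ u v, D u v = D v u) :
    ∃ S : Finset V, (∀ u ∈ S, ∀ v ∈ S, u ≠ v → f u + f v ≤ D u v) ∧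
      ∀ v, ∃ u ∈ S, f u ≤ f v ∧ D v u ≤ 2 * f v := by
  suffices h : ∀ S₀ : Finset V, ∃ S ⊆ S₀, (∀ u ∈ S, ∀ v ∈ S, u ≠ v → f u + f v ≤ D u v) ∧
      ∀ v ∈ S₀, ∃ u ∈ S, f u ≤ f v ∧ D v u ≤ 2 * f v by
    obtain ⟨S, -, hsep, hnear⟩ := h Finset.univ
    exact ⟨S, hsep, fun v => hnear v (Finset.mem_univ v)⟩
  intro S₀
  induction S₀ using Finset.induction_on_max_value f with
  | empty => exact ⟨∅, subset_rfl, by simp, by simp⟩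
  | insert a S₀ ha hmax ih =>
    obtain ⟨S, hS, hsep, hnear⟩ := ih
    by_cases hfar : ∀ u ∈ S, f u + f a ≤ D a u
    · refine ⟨insert a S, Finset.insert_subset_insert _ hS, ?_, ?_⟩
      · intro u hu v hv huv
        rcases Finset.mem_insert.mp hu with rfl | hu' <;>
          rcases Finset.mem_insert.mp hv with rfl | hv'
        · exact absurd rfl huv
        · linarith [hfar v hv']
        · rw [hDsymm]
          exact hfar u hu'
        · exact hsep u hu' v hv' huv
      · intro v hv
        rcases Finset.mem_insert.mp hv with rfl | hv
        · exact ⟨v, Finset.mem_insert_self _ _, le_rfl, by linarith [hD0 v, hf v]⟩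
        · obtain ⟨u, hu, h⟩ := hnear v hv
          exact ⟨u, Finset.mem_insert_of_mem hu, h⟩
    · push Not at hfar
      obtain ⟨u, hu, hlt⟩ := hfar
      refine ⟨S, hS.trans (Finset.subset_insert _ _), hsep, fun v hv => ?_⟩
      rcases Finset.mem_insert.mp hv with rfl | hv
      · have := hmax u (hS hu)
        exact ⟨u, hu, this, by linarith⟩
      · exact hnear v hv

lemma sub_le_walkWeight_osc {G : SimpleGraph V} (g : V → ℝ) {x y : V} (p : G.Walk x y) :
    g x - g y ≤ walkWeight (fun e => (e.map g).sup - (e.map g).inf) p := by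
  induction p with
  | nil => simp
  | @cons i j k h q ih =>
    rw [walkWeight_cons, Sym2.map_mk, Sym2.sup_mk, Sym2.inf_mk, sup_sub_inf_eq_abs_sub]
    linarith [neg_abs_le (g j - g i)]

/-- Truncated distance functions of non-overlapping balls have total variation at most the
distance. -/
lemma sum_abs_sub_le_of_separated (S : Finset V) (D : V → V → ℝ) (f : V → ℝ)
    (hDsymm : ∀ u v, D u v = D v u) (hDtri : ∀ u v x, D u x ≤ D u v + D v x)
    (hD0 : ∀ u v, 0 ≤ D u v)
    (hsep : ∀ u ∈ S, ∀ v ∈ S, u ≠ v → f u + f v ≤ D u v) (x y : V) :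
    ∑ v ∈ S, |max 0 (f v - D v x) - max 0 (f v - D v y)| ≤ D x y := by
  rcases S.eq_empty_or_nonempty with rfl | ⟨s, hs⟩
  · simpa using hD0 x y
  have huniq : ∀ z, ∃ m ∈ S, ∀ v ∈ S, v ≠ m → max 0 (f v - D v z) = 0 := by
    intro z
    by_cases h : ∃ m ∈ S, 0 < f m - D m z
    · obtain ⟨m, hm, hpos⟩ := h
      refine ⟨m, hm, fun v hv hvm => max_eq_left ?_⟩
      linarith [hsep v hv m hm hvm, hDtri v z m, hDsymm z m]
    · push Not at h
      exact ⟨s, hs, fun v hv _ => max_eq_left (h v hv)⟩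
  have hlip : ∀ v, |max 0 (f v - D v x) - max 0 (f v - D v y)| ≤ D x y := by
    intro v
    have h := abs_max_sub_max_le_abs (f v - D v x) (f v - D v y) 0
    rw [max_comm _ 0, max_comm _ 0] at h
    refine h.trans (abs_le.mpr ⟨?_, ?_⟩) <;>
      linarith [hDtri v x y, hDtri v y x, hDsymm x y]
  obtain ⟨a, ha, hxa⟩ := huniq x
  obtain ⟨b, hb, hyb⟩ := huniq y
  by_cases hab : a = b
  · subst hab
    rw [Finset.sum_eq_single_of_mem a ha fun v hv hva => by simp [hxa v hv hva, hyb v hv hva]]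
    exact hlip a
  · have hsub : ({a, b} : Finset V) ⊆ S := by
      simp [Finset.insert_subset_iff, ha, hb]
    rw [← Finset.sum_subset hsub fun v hv hvab => by
      simp only [Finset.mem_insert, Finset.mem_singleton, not_or] at hvab
      simp [hxa v hv hvab.1, hyb v hv hvab.2], Finset.sum_pair hab]
    have hya := hyb a ha hab
    have hxb := hxa b hb (Ne.symm hab)
    have hla := hlip a
    have hlb := hlip b
    rw [hya, sub_zero] at hla ⊢
    rw [hxb, zero_sub, abs_neg] at hlb ⊢
    rw [abs_of_nonneg (le_max_left _ _)] at hla hlb ⊢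
    rw [abs_of_nonneg (le_max_left _ _)]
    have := hsep a ha b hb hab
    have h₁ := hDtri a x b
    have h₂ := hDtri x y b
    have h₃ := hDsymm y b
    rcases max_cases 0 (f a - D a x) with h | h <;>
      rcases max_cases 0 (f b - D b y) with h' | h' <;> linarith

/-- Non-overlapping balls in a weighted graph, one of which has radius zero, have total radius
at most the weight of the graph. -/
lemma sum_le_wWeight_of_separated [Fintype V] {T : SimpleGraph V} {d : Sym2 V → ℝ}
    (hT : T.Connected) (hd : ∀ e ∈ T.edgeSet, 0 ≤ d e) (S : Finset V) (f : V → ℝ)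
    (hf : ∀ v, 0 ≤ f v)
    (hsep : ∀ u ∈ S, ∀ v ∈ S, u ≠ v → f u + f v ≤ wdist T d u v) {r : V} (hr : r ∈ S)
    (hfr : f r = 0) : ∑ v ∈ S, f v ≤ wWeight T d := by
  set φ : V → V → ℝ := fun v x => max 0 (f v - wdist T d v x) with hφ
  have hosc : ∀ v ∈ S,
      f v ≤ ∑ e ∈ T.edgeFinset, ((e.map (φ v)).sup - (e.map (φ v)).inf) := by
    intro v hv
    obtain ⟨p, hp, -⟩ := exists_isPath_walkWeight_eq_wdist hT hd v r
    have h₁ := sub_le_walkWeight_osc (φ v) p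
    have h₂ := walkWeight_le_wWeight_of_isPath
      (w := fun e => (e.map (φ v)).sup - (e.map (φ v)).inf)
      (fun e _ => by induction e with | h x y => simp) hp
    rw [wWeight_eq_sum T.edgeFinset (by simp)] at h₂
    have hvv : φ v v = f v := by simp [hφ, wdist_self hT hd, hf v]
    have hvr : φ v r = 0 := by
      refine max_eq_left ?_
      rcases eq_or_ne v r with rfl | hne
      · simp [hfr, wdist_self hT hd]
      · linarith [hsep v hv r hr hne]
    linarith
  refine (Finset.sum_le_sum hosc).trans ?_
  rw [Finset.sum_comm, wWeight_eq_sum T.edgeFinset (by simp)]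
  refine Finset.sum_le_sum fun e he => ?_
  induction e with | h x y =>
  have hxy : T.Adj x y := by simpa using he
  refine le_trans (le_of_eq ?_) ((sum_abs_sub_le_of_separated S (wdist T d) f
    (wdist_comm hT hd) (wdist_triangle hT hd) (wdist_nonneg hT hd) hsep x y).trans
    (wdist_le_of_adj hd hxy))
  refine Finset.sum_congr rfl fun v _ => ?_
  rw [Sym2.map_mk, Sym2.sup_mk, Sym2.inf_mk, sup_sub_inf_eq_abs_sub, abs_sub_comm]

end Net

/-- The shortest-path metric, as a function on unordered pairs. -/
noncomputable def pairDist {V : Type*} (G : SimpleGraph V) (w : Sym2 V → ℝ) : Sym2 V → ℝ :=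
  Sym2.lift ⟨wdist G w, fun u v => congrArg sInf <| Set.ext fun x => by
    constructor <;> rintro ⟨p, rfl⟩ <;> exact ⟨p.reverse, (walkWeight_reverse p).symm⟩⟩

@[simp] lemma pairDist_mk {V : Type*} (G : SimpleGraph V) (w : Sym2 V → ℝ) (u v : V) :
    pairDist G w s(u, v) = wdist G w u v := rfl

section Realization

variable {V : Type*} [Fintype V] {G T : SimpleGraph V} {w : Sym2 V → ℝ}

lemma isSymPseudometric_pairDist (hG : G.Connected) (hw : ∀ e ∈ G.edgeSet, 0 ≤ w e) :
    IsSymPseudometric (pairDist G w) where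
  nonneg e := by
    induction e with | h u v =>
    exact wdist_nonneg hG hw u v
  self x := wdist_self hG hw x
  triangle x y z := wdist_triangle hG hw x y z

/-- A set of vertex pairs can be realized by shortest paths at a cost of at most the sum of the
distances. -/
lemma exists_realization (hG : G.Connected) (hw : ∀ e ∈ G.edgeSet, 0 ≤ w e) (hT : T ≤ G)
    (E : Finset (Sym2 V)) :
    ∃ H ≤ G, T ≤ H ∧ wWeight H w ≤ wWeight T w + ∑ e ∈ E, pairDist G w e ∧
      ∀ a b, s(a, b) ∈ E → ∃ p : H.Walk a b, walkWeight w p ≤ pairDist G w s(a, b) := by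
  induction E using Finset.induction_on with
  | empty => exact ⟨T, hT, le_rfl, by simp, by simp⟩
  | insert e E he ih =>
    obtain ⟨H, hHG, hTH, hweight, hwalk⟩ := ih
    induction e with | h x y =>
    obtain ⟨p, hp, hpw⟩ := exists_isPath_walkWeight_eq_wdist hG hw x y
    have hpG : ∀ e ∈ p.edges, e ∈ G.edgeSet := fun e he => p.edges_subset_edgeSet he
    set P := SimpleGraph.fromEdgeSet {e | e ∈ p.edges} with hP
    have hPG : P ≤ G := fun a b hab => hpG _ ((SimpleGraph.fromEdgeSet_adj _).mp hab).1
    have hpP : ∀ e ∈ p.edges, e ∈ P.edgeSet := fun e he => by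
      rw [hP, SimpleGraph.edgeSet_fromEdgeSet]
      exact ⟨he, G.not_isDiag_of_mem_edgeSet (hpG e he)⟩
    have hpH : ∀ e ∈ p.edges, e ∈ (H ⊔ P).edgeSet := fun e he =>
      SimpleGraph.edgeSet_mono le_sup_right (hpP e he)
    refine ⟨H ⊔ P, sup_le hHG hPG, hTH.trans le_sup_left, ?_, ?_⟩
    · have hsup : wWeight (H ⊔ P) w ≤ wWeight H w + walkWeight w p := by
        rw [wWeight_eq_sum (G := H ⊔ P) (H.edgeFinset ∪ p.edges.toFinset) ?_,
          wWeight_eq_sum H.edgeFinset (by simp), walkWeight,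
          ← List.sum_toFinset w hp.isTrail.edges_nodup, ← Finset.sum_union_inter]
        · refine le_add_of_nonneg_right (Finset.sum_nonneg fun e he => ?_)
          exact hw e (hpG e (List.mem_toFinset.mp (Finset.mem_inter.mp he).2))
        · ext e
          simp only [Finset.coe_union, SimpleGraph.coe_edgeFinset, List.coe_toFinset,
            SimpleGraph.edgeSet_sup, Set.mem_union, Set.mem_ofPred_eq]
          refine or_congr_right ⟨hpP e, fun h => ?_⟩
          rw [hP, SimpleGraph.edgeSet_fromEdgeSet] at h
          exact h.1
      rw [Finset.sum_insert he, pairDist_mk]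
      linarith
    · intro a b hab
      have hxy : ∃ q : (H ⊔ P).Walk x y, walkWeight w q ≤ pairDist G w s(x, y) :=
        ⟨p.transfer _ hpH, by rw [walkWeight_transfer, pairDist_mk, hpw]⟩
      rcases Finset.mem_insert.mp hab with h | h
      · rcases Sym2.eq_iff.mp h with ⟨rfl, rfl⟩ | ⟨rfl, rfl⟩
        · exact hxy
        · obtain ⟨q, hq⟩ := hxy
          exact ⟨q.reverse, by rwa [walkWeight_reverse, Sym2.eq_swap]⟩
      · obtain ⟨q, hq⟩ := hwalk a b h
        exact ⟨q.mapLe le_sup_left, by rwa [walkWeight_mapLe]⟩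

lemma wdist_le_walkWeight_of_adj {A H : SimpleGraph V} {d : Sym2 V → ℝ} (hH : H.Connected)
    (hw : ∀ e ∈ H.edgeSet, 0 ≤ w e) (hA : ∀ x y, A.Adj x y → wdist H w x y ≤ d s(x, y))
    {x y : V} (p : A.Walk x y) : wdist H w x y ≤ walkWeight d p := by
  induction p with
  | nil => simp [wdist_self hH hw]
  | @cons i j k h q ih =>
    rw [walkWeight_cons]
    linarith [wdist_triangle hH hw i j k, hA i j h]

lemma wdist_anti {H : SimpleGraph V} (hH : H.Connected) (hHG : H ≤ G)
    (hw : ∀ e ∈ G.edgeSet, 0 ≤ w e) (x y : V) : wdist G w x y ≤ wdist H w x y := by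
  obtain ⟨p, -, hp⟩ := exists_isPath_walkWeight_eq_wdist hH
    (fun e he => hw e (SimpleGraph.edgeSet_mono hHG he)) x y
  simpa [hp] using wdist_le hw (p.mapLe hHG)

/-- A spanning tree whose edges are shortest paths extends to a spanner of at most three times its
weight with logarithmic distortion on the pairs in `K × V`. -/
lemma exists_spanner_of_short_tree (hw : ∀ e ∈ G.edgeSet, 0 ≤ w e)
    (hTG : T ≤ G) (hT : T.IsTree)
    (hshort : ∀ a b, T.Adj a b → ∀ p : G.Walk a b, w s(a, b) ≤ walkWeight w p)
    {K : Finset V} (hK : K.Nonempty) :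
    ∃ H ≤ G, T ≤ H ∧ wWeight H w ≤ 3 * wWeight T w ∧ ∀ u ∈ K, ∀ v,
      wdist H w u v ≤ (40 * (harmonic K.card : ℝ) + 3) * wdist G w u v := by
  have hTc : T.Connected := hT.1
  have hG : G.Connected := hTc.mono hTG
  have hwT : ∀ e ∈ T.edgeSet, 0 ≤ w e := fun e he => hw e (SimpleGraph.edgeSet_mono hTG he)
  set h : ℝ := (harmonic K.card : ℝ) with hh
  have hh1 : 1 ≤ h := by
    have hc : 0 < K.card := hK.card_pos
    have : (1 : ℚ) ≤ harmonic K.card := by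
      rw [harmonic]
      refine le_trans (by simp) (Finset.single_le_sum (fun i _ => by positivity)
        (Finset.mem_range.mpr hc))
    rw [hh]
    exact_mod_cast this
  set d := pairDist G w with hd_def
  have hd : IsSymPseudometric d := isSymPseudometric_pairDist hG hw
  have hdmk : ∀ x y, d s(x, y) = wdist G w x y := pairDist_mk G w
  have hLd : wWeight T d ≤ wWeight T w := by
    rw [wWeight_eq_sum T.edgeFinset (by simp), wWeight_eq_sum T.edgeFinset (by simp)]
    refine Finset.sum_le_sum fun e he => ?_
    induction e with | h x y =>
    rw [hdmk]
    exact wdist_le_of_adj hw (hTG (by simpa using he))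
  obtain ⟨F, hFK, hF, hFnew, hFspan⟩ :=
    exists_greedy_spanner (T := T) hd (show 1 ≤ 10 * h by linarith) K.sym2
  have hFK' : ∀ e ∈ F, ∀ x ∈ e, x ∈ K := fun e he => Finset.mem_sym2_iff.mp (hFK he)
  have hFweight : ∑ e ∈ F, d e ≤ wWeight T w := by
    have := hF.sum_le hd hT (fun e he => (hFnew e he).1) (fun e he => (hFnew e he).2) hFK'
      (by linarith)
    rw [← hh] at this
    have h₂ : h * (∑ e ∈ F, d e) ≤ h * wWeight T d := by linarith
    exact (le_of_mul_le_mul_left h₂ (by linarith)).trans hLd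
  have hnearest : ∀ v, ∃ x ∈ K, ∀ y ∈ K, d s(v, x) ≤ d s(v, y) := fun v =>
    K.exists_min_image (fun x => d s(v, x)) hK
  choose τ hτK hτ using hnearest
  obtain ⟨S, hsep, hnet⟩ := exists_separated_net (wdist T w) (fun v => d s(v, τ v))
    (fun v => hd.nonneg _) (wdist_self hTc hwT) (wdist_comm hTc hwT)
  have hSweight : ∑ v ∈ S, d s(v, τ v) ≤ wWeight T w := by
    obtain ⟨k, hk⟩ := hK
    obtain ⟨r, hrS, hr, -⟩ := hnet k
    refine sum_le_wWeight_of_separated hTc hwT S (fun v => d s(v, τ v)) (fun v => hd.nonneg _)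
      hsep hrS (le_antisymm (hr.trans ?_) (hd.nonneg _))
    exact (hτ k k hk).trans_eq (hd.self k)
  obtain ⟨H, hHG, hTH, hweight, hwalk⟩ :=
    exists_realization hG hw hTG (F ∪ S.image fun v => s(v, τ v))
  have hHc : H.Connected := hTc.mono hTH
  have hwH : ∀ e ∈ H.edgeSet, 0 ≤ w e := fun e he => hw e (SimpleGraph.edgeSet_mono hHG he)
  refine ⟨H, hHG, hTH, ?_, fun u hu v => ?_⟩
  · have h₁ : ∑ e ∈ F ∪ S.image fun v => s(v, τ v), d e ≤
        ∑ e ∈ F, d e + ∑ e ∈ S.image fun v => s(v, τ v), d e := by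
      rw [← Finset.sum_union_inter]
      exact le_add_of_nonneg_right (Finset.sum_nonneg fun e _ => hd.nonneg e)
    have h₂ : ∑ e ∈ S.image fun v => s(v, τ v), d e ≤ ∑ v ∈ S, d s(v, τ v) :=
      Finset.sum_image_le_of_nonneg fun e _ => hd.nonneg e
    linarith
  · have hreal : ∀ a b, s(a, b) ∈ F ∪ S.image (fun v => s(v, τ v)) →
        wdist H w a b ≤ d s(a, b) := fun a b hab => by
      obtain ⟨p, hp⟩ := hwalk a b hab
      exact (wdist_le hwH p).trans hp
    have hadj : ∀ x y, (T ⊔ SimpleGraph.fromEdgeSet (F : Set (Sym2 V))).Adj x y →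
        wdist H w x y ≤ d s(x, y) := by
      rintro x y (hxy | hxy)
      · obtain ⟨p, -, hp⟩ := exists_isPath_walkWeight_eq_wdist hG hw x y
        rw [hdmk, ← hp]
        exact (wdist_le_of_adj hwH (hTH hxy)).trans (hshort x y hxy p)
      · exact hreal x y (Finset.mem_union_left _ ((SimpleGraph.fromEdgeSet_adj _).mp hxy).1)
    obtain ⟨v', hv'S, hfv', hvv'⟩ := hnet v
    obtain ⟨p, hp⟩ := hFspan u (τ v') (Finset.mk_mem_sym2_iff.mpr ⟨hu, hτK v'⟩)
    have h₁ := (wdist_le_walkWeight_of_adj hHc hwH hadj p).trans hp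
    have h₂ := hreal v' (τ v')
      (Finset.mem_union_right _ (Finset.mem_image_of_mem _ hv'S))
    have h₃ := hτ v u hu
    simp only [hdmk] at h₁ h₂ h₃ hfv' hvv'
    have h₄ := wdist_anti hTc hTG hw v v'
    have h₅ := wdist_anti hTc hTH hwH v v'
    have h₆ : wdist G w u (τ v') ≤ 4 * wdist G w u v := by
      linarith [wdist_triangle hG hw u v (τ v'), wdist_triangle hG hw v v' (τ v'),
        wdist_comm hG hw u v]
    have h₇ : 10 * h * wdist G w u (τ v') ≤ 10 * h * (4 * wdist G w u v) :=
      mul_le_mul_of_nonneg_left h₆ (by linarith)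
    linarith [wdist_triangle hHc hwH u (τ v') v, wdist_triangle hHc hwH (τ v') v' v,
      wdist_comm hHc hwH v v', wdist_comm hHc hwH v' (τ v'), wdist_comm hG hw u v]

end Realization

section MinimumSpanningTree

variable {V : Type*} [Fintype V] {G T : SimpleGraph V} {w : Sym2 V → ℝ}

lemma exists_isMST (hG : G.Connected) (w : Sym2 V → ℝ) : ∃ T, IsMST G w T := by
  obtain ⟨T₀, hT₀⟩ := hG.exists_isTree_le
  obtain ⟨T, hT, hmin⟩ := Set.exists_min_image {T | IsSpanningTree G T} (fun T => wWeight T w)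
    (Set.toFinite _) ⟨T₀, hT₀⟩
  exact ⟨T, hT, hmin⟩

lemma IsMST.mstWeight_eq (hT : IsMST G w T) : mstWeight G w = wWeight T w :=
  IsLeast.csInf_eq ⟨⟨T, hT.1, rfl⟩, by rintro _ ⟨T', hT', rfl⟩; exact hT.2 T' hT'⟩

/-- Every walk between the endpoints of a tree edge uses an edge that is at least as heavy. -/
lemma IsMST.exists_mem_edges_le (hT : IsMST G w T) (hw : ∀ e ∈ G.edgeSet, 0 ≤ w e) {a b : V}
    (hab : T.Adj a b) (p : G.Walk a b) : ∃ f ∈ p.edges, w s(a, b) ≤ w f := by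
  set T₀ := T.deleteEdges {s(a, b)} with hT₀
  have hbridge : ¬ T₀.Reachable a b :=
    SimpleGraph.isBridge_iff.mp (SimpleGraph.isAcyclic_iff_forall_isBridge.mp hT.1.2.2
      (T.mem_edgeSet.mpr hab))
  obtain ⟨⟨⟨x, y⟩, hxy⟩, hxyp, hx, hy⟩ := p.exists_boundary_dart {z | T₀.Reachable a z}
    (SimpleGraph.Reachable.refl a) hbridge
  have hxyp' : s(x, y) ∈ p.edges := List.mem_map_of_mem (f := SimpleGraph.Dart.edge) hxyp
  refine ⟨s(x, y), hxyp', ?_⟩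
  have hsplit : ∀ z, T₀.Reachable a z ∨ T₀.Reachable b z := by
    have hwalk : ∀ {z y : V} (_ : T.Walk z y), T₀.Reachable a y ∨ T₀.Reachable b y →
        T₀.Reachable a z ∨ T₀.Reachable b z := by
      intro z y q hq
      induction q with
      | nil => exact hq
      | @cons i j k hij q ih =>
        by_cases he : s(i, j) = s(a, b)
        · rcases Sym2.eq_iff.mp he with ⟨rfl, rfl⟩ | ⟨rfl, rfl⟩
          · exact Or.inl (SimpleGraph.Reachable.refl _)
          · exact Or.inr (SimpleGraph.Reachable.refl _)
        · have hji : T₀.Adj j i :=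
            (SimpleGraph.deleteEdges_adj.mpr ⟨hij, by simpa using he⟩).symm
          exact (ih hq).imp (·.trans hji.reachable) (·.trans hji.reachable)
    intro z
    obtain ⟨q⟩ := hT.1.2.1 z a
    exact hwalk q (Or.inl (SimpleGraph.Reachable.refl _))
  set T₁ := T₀ ⊔ SimpleGraph.edge x y with hT₁
  have hT₀₁ : T₀ ≤ T₁ := le_sup_left
  have hab₁ : T₁.Reachable a b := by
    have hxy₁ : T₁.Adj x y := Or.inr (by simp [SimpleGraph.edge_adj, hxy.ne])
    exact (SimpleGraph.Reachable.mono hT₀₁ hx).trans <| hxy₁.reachable.trans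
      (((hsplit y).resolve_left hy).symm.mono hT₀₁)
  have hconn : T₁.Connected := by
    have := hT.1.2.1.nonempty
    refine ⟨fun u v => ?_⟩
    have key : ∀ z, T₁.Reachable a z := fun z => (hsplit z).elim (·.mono hT₀₁)
      fun h => hab₁.trans (h.mono hT₀₁)
    exact (key u).symm.trans (key v)
  have hT₁G : T₁ ≤ G := sup_le ((SimpleGraph.deleteEdges_le _).trans hT.1.1)
    ((SimpleGraph.edge_le_iff G).mpr (Or.inr hxy))
  obtain ⟨T₂, hT₂, hT₂tree⟩ := hconn.exists_isTree_le
  have hle := hT.2 T₂ ⟨hT₂.trans hT₁G, hT₂tree⟩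
  have hsub : T₂.edgeFinset ⊆ insert s(x, y) (T.edgeFinset.erase s(a, b)) := by
    intro e he
    have he' : e ∈ T₁.edgeSet := SimpleGraph.edgeSet_mono hT₂ (by simpa using he)
    rw [hT₁, SimpleGraph.edgeSet_sup] at he'
    rcases he' with he' | he'
    · rw [hT₀, SimpleGraph.edgeSet_deleteEdges] at he'
      simp only [Finset.mem_insert, Finset.mem_erase, SimpleGraph.mem_edgeFinset]
      exact Or.inr ⟨he'.2, he'.1⟩
    · rw [SimpleGraph.edge, SimpleGraph.edgeSet_fromEdgeSet] at he'
      exact Finset.mem_insert.mpr (Or.inl he'.1)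
  have hnonneg : ∀ e ∈ insert s(x, y) (T.edgeFinset.erase s(a, b)), 0 ≤ w e := by
    intro e he
    rcases Finset.mem_insert.mp he with rfl | he
    · exact hw _ hxy
    · refine hw e (SimpleGraph.edgeSet_mono hT.1.1 ?_)
      simpa using Finset.mem_of_mem_erase he
  have h₁ := Finset.sum_le_sum_of_subset_of_nonneg hsub fun e he _ => hnonneg e he
  have h₂ : ∑ e ∈ insert s(x, y) (T.edgeFinset.erase s(a, b)), w e ≤
      w s(x, y) + ∑ e ∈ T.edgeFinset.erase s(a, b), w e := by
    by_cases hmem : s(x, y) ∈ T.edgeFinset.erase s(a, b)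
    · rw [Finset.insert_eq_of_mem hmem]
      linarith [hw _ (G.mem_edgeSet.mpr hxy)]
    · rw [Finset.sum_insert hmem]
  have h₃ := Finset.add_sum_erase T.edgeFinset w
    (SimpleGraph.mem_edgeFinset.mpr (T.mem_edgeSet.mpr hab))
  rw [wWeight_eq_sum T.edgeFinset (by simp), wWeight_eq_sum T₂.edgeFinset (by simp)] at hle
  linarith

lemma IsMST.wWeight_pos [Nontrivial V] (hT : IsMST G w T) (hw : ∀ e ∈ G.edgeSet, 0 < w e) :
    0 < wWeight T w := by
  have hwT : ∀ e ∈ T.edgeSet, 0 < w e := fun e he => hw e (SimpleGraph.edgeSet_mono hT.1.1 he)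
  obtain ⟨a, b, hab⟩ := exists_pair_ne V
  obtain ⟨p, hp, hpw⟩ :=
    exists_isPath_walkWeight_eq_wdist hT.1.2.1 (fun e he => (hwT e he).le) a b
  exact (wdist_pos_of_ne hT.1.2.1 hwT hab).trans_le
    (hpw ▸ walkWeight_le_wWeight_of_isPath (fun e he => (hwT e he).le) hp)

end MinimumSpanningTree

section Reweighting

variable {V : Type*} [Fintype V] {G : SimpleGraph V} {w w' : Sym2 V → ℝ}

lemma mul_wdist_le {c : ℝ} (hc : 0 ≤ c) (hG : G.Connected) (hw : ∀ e ∈ G.edgeSet, 0 ≤ w e)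
    (hww' : ∀ e ∈ G.edgeSet, c * w e ≤ w' e) (u v : V) :
    c * wdist G w u v ≤ wdist G w' u v := by
  obtain ⟨p, -, hp⟩ := exists_isPath_walkWeight_eq_wdist (w := w') hG
    (fun e he => (mul_nonneg hc (hw e he)).trans (hww' e he)) u v
  rw [← hp]
  refine (mul_le_mul_of_nonneg_left (wdist_le hw p) hc).trans ?_
  rw [walkWeight, ← List.sum_map_mul_left]
  exact List.sum_le_sum fun e he => hww' e (p.edges_subset_edgeSet he)

lemma wWeight_eq_add_sum_sdiff {T H : SimpleGraph V} (hTH : T ≤ H) (w : Sym2 V → ℝ) :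
    wWeight H w = wWeight T w + ∑ e ∈ H.edgeFinset \ T.edgeFinset, w e := by
  rw [wWeight_eq_sum (G := T) T.edgeFinset (by simp),
    wWeight_eq_sum (G := H) H.edgeFinset (by simp), add_comm,
    Finset.sum_sdiff (SimpleGraph.edgeFinset_mono hTH)]

end Reweighting

lemma one_le_logb_two {k : ℕ} (hk : 2 ≤ k) : 1 ≤ Real.logb 2 k := by
  have hk' : (2 : ℝ) ≤ k := by exact_mod_cast hk
  rw [Real.le_logb_iff_rpow_le one_lt_two (by linarith)]
  simpa using hk'

lemma harmonic_le_two_mul_logb {k : ℕ} (hk : 2 ≤ k) :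
    (harmonic k : ℝ) ≤ 2 * Real.logb 2 k := by
  have h : Real.log k ≤ Real.logb 2 k := by
    rw [Real.logb, le_div_iff₀ (Real.log_pos one_lt_two)]
    nlinarith [Real.log_two_lt_d9, Real.log_natCast_nonneg k]
  linarith [harmonic_le_one_add_log k, one_le_logb_two hk]

/-- There is a universal constant `C > 0` such that for every weighted
graph `G`, every subset `K ⊆ V` with `|K| = k ≥ 2` and every `0 < δ < 1`, there is a
spanner `H` containing the MST of `G`, of lightness at most `1 + δ`, in which every pair
in `K × V` has distortion at most `C·log₂(k)/δ`. -/
theorem stmt4 :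
    ∃ C : ℝ, 0 < C ∧
      ∀ (V : Type) [Fintype V] (G : SimpleGraph V) (w : Sym2 V → ℝ),
        IsWeightedGraph G w →
        ∀ K : Finset V, 2 ≤ K.card →
        ∀ δ : ℝ, 0 < δ → δ < 1 →
          ∃ H : SimpleGraph V, IsSpanner G H ∧
            (∃ T : SimpleGraph V, IsMST G w T ∧ T ≤ H) ∧
            wWeight H w / mstWeight G w ≤ 1 + δ ∧
            ∀ u ∈ K, ∀ v : V,
              wdist H w u v ≤ (C * Real.logb 2 (K.card : ℝ) / δ) * wdist G w u v := by
  refine ⟨166, by norm_num, fun V _ G w hGw K hK δ hδ0 hδ1 => ?_⟩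
  obtain ⟨hG, hwpos, -⟩ := hGw
  have hw : ∀ e ∈ G.edgeSet, 0 ≤ w e := fun e he => (hwpos e he).le
  obtain ⟨a, -, b, -, hab⟩ := Finset.one_lt_card.mp hK
  have : Nontrivial V := ⟨a, b, hab⟩
  obtain ⟨T, hT⟩ := exists_isMST hG w
  have hTpos := hT.wWeight_pos hwpos
  set w' : Sym2 V → ℝ := fun e => if e ∈ T.edgeSet then δ / 2 * w e else w e with hw'
  have hlow : ∀ e ∈ G.edgeSet, δ / 2 * w e ≤ w' e := fun e he => by
    simp only [hw']
    split_ifs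
    · exact le_rfl
    · nlinarith [hw e he]
  have hupp : ∀ e ∈ G.edgeSet, 1 * w' e ≤ w e := fun e he => by
    simp only [hw']
    split_ifs
    · nlinarith [hw e he]
    · exact (one_mul _).le
  have hw0 : ∀ e ∈ G.edgeSet, 0 ≤ w' e := fun e he =>
    (mul_nonneg (by linarith) (hw e he)).trans (hlow e he)
  have hshort : ∀ a b, T.Adj a b → ∀ p : G.Walk a b, w' s(a, b) ≤ walkWeight w' p := by
    intro a b hab p
    obtain ⟨f, hf, hle⟩ := hT.exists_mem_edges_le hw hab p
    refine le_trans ?_ (le_walkWeight_of_mem_edges hw0 hf)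
    refine le_trans ?_ (hlow f (p.edges_subset_edgeSet hf))
    simp only [hw', if_pos (T.mem_edgeSet.mpr hab)]
    exact mul_le_mul_of_nonneg_left hle (by linarith)
  obtain ⟨H, hHG, hTH, hweight, hdist⟩ := exists_spanner_of_short_tree hw0 hT.1.1 hT.1.2 hshort
    (K := K) (Finset.card_pos.mp (by omega))
  have hHc : H.Connected := hT.1.2.1.mono hTH
  refine ⟨H, ⟨hHG, hHc⟩, ⟨T, hT, hTH⟩, ?_, fun u hu v => ?_⟩
  · rw [hT.mstWeight_eq, div_le_iff₀ hTpos, wWeight_eq_add_sum_sdiff hTH]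
    have h₁ : wWeight T w' = δ / 2 * wWeight T w := by
      rw [wWeight_eq_sum T.edgeFinset (by simp), wWeight_eq_sum T.edgeFinset (by simp),
        Finset.mul_sum]
      exact Finset.sum_congr rfl fun e he => if_pos (by simpa using he)
    have h₂ : ∑ e ∈ H.edgeFinset \ T.edgeFinset, w' e =
        ∑ e ∈ H.edgeFinset \ T.edgeFinset, w e :=
      Finset.sum_congr rfl fun e he => if_neg (by simpa using (Finset.mem_sdiff.mp he).2)
    rw [wWeight_eq_add_sum_sdiff hTH, h₁, h₂] at hweight
    linarith
  · have hharm := harmonic_le_two_mul_logb hK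
    have hlog := one_le_logb_two hK
    have h₁ := mul_wdist_le (w' := w') (c := δ / 2) (by linarith) hHc
      (fun e he => hw e (SimpleGraph.edgeSet_mono hHG he))
      (fun e he => hlow e (SimpleGraph.edgeSet_mono hHG he)) u v
    have h₂ := mul_wdist_le (w := w') zero_le_one hG hw0 hupp u v
    have h₃ : (40 * (harmonic K.card : ℝ) + 3) * wdist G w' u v ≤
        83 * Real.logb 2 K.card * wdist G w u v :=
      mul_le_mul (by linarith) (by linarith) (wdist_nonneg hG hw0 u v) (by linarith)
    rw [div_mul_eq_mul_div, le_div_iff₀ hδ0]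
    linarith [hdist u hu v]
end

section
/- Let (X,d_X) be a finite metric space with n = |X| points. Then there exists a priority ranking x_1,…,x_n of the points of X such that the following holds: for every metric space (Y,d_Y), every monotone non-decreasing α:ℕ→ℝ≥0, and every non-contractive map f:X→Y with prioritized distortion α (with respect to this ranking), for every ε ∈ (0,1) and every pair of distinct points u,v ∈ X such that u is ε/2-far from v and v is ε/2-far from u, it holds that d_Y(f(u),f(v)) ≤ 5·α(⌈8/ε⌉)·d_X(u,v). -/
open Finset

attribute [local instance] Classical.propDecidable

/-- `R(x,ε)`: the minimal radius `r ≥ 0` such that the closed ball `B(x,r)` contains at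
least `ε·|X|` points. -/
noncomputable def Rmet (X : Type*) [MetricSpace X] [Fintype X] (x : X) (ε : ℝ) : ℝ :=
  sInf {r : ℝ | 0 ≤ r ∧
    ε * (Fintype.card X : ℝ) ≤ ((Finset.univ.filter (fun z => dist z x ≤ r)).card : ℝ)}

/-- Greedy selection by increasing radius: the selected balls `B y`, `y ∈ N`, are disjoint, and
every ball is either selected or meets a selected ball of no larger radius. -/
theorem exists_disjoint_subfamily_of_radius {X β : Type*} (r : X → ℝ) (B : X → Finset β)
    (s : Finset X) :
    ∃ N ⊆ s, (N : Set X).PairwiseDisjoint B ∧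
      ∀ x ∈ s, x ∈ N ∨ ∃ y ∈ N, r y ≤ r x ∧ ¬ Disjoint (B x) (B y) := by
  induction s using Finset.induction_on_max_value r with
  | empty => exact ⟨∅, by simp, by simp, by simp⟩
  | insert a s _ hmax ih =>
    obtain ⟨N, hNs, hN, hcov⟩ := ih
    by_cases ha : ∃ y ∈ N, ¬ Disjoint (B a) (B y)
    · obtain ⟨y, hy, hay⟩ := ha
      refine ⟨N, hNs.trans (Finset.subset_insert a s), hN, fun x hx => ?_⟩
      rcases Finset.mem_insert.1 hx with rfl | hx
      · exact Or.inr ⟨y, hy, hmax y (hNs hy), hay⟩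
      · exact hcov x hx
    · push Not at ha
      refine ⟨insert a N, Finset.insert_subset_insert a hNs, ?_, fun x hx => ?_⟩
      · rw [Finset.coe_insert]
        exact hN.insert fun y hy _ => ha y hy
      · rcases Finset.mem_insert.1 hx with rfl | hx
        · exact Or.inl (Finset.mem_insert_self x N)
        · rcases hcov x hx with h | ⟨y, hy, h⟩
          · exact Or.inl (Finset.mem_insert_of_mem h)
          · exact Or.inr ⟨y, Finset.mem_insert_of_mem hy, h⟩

/-- For `δ ≤ 1` some ball around `x` with at least `δ|X|` points has radius at most
`Rmet X x δ'` for all `δ' ∈ [δ, 1]`. -/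
theorem exists_radius_le_Rmet {X : Type*} [MetricSpace X] [Fintype X] {δ : ℝ}
    (hδ : 0 < δ) (hδ1 : δ ≤ 1) (x : X) :
    ∃ r : ℝ, 0 ≤ r ∧
      δ * (Fintype.card X : ℝ) ≤ ((Finset.univ.filter (fun z => dist z x ≤ r)).card : ℝ) ∧
      ∀ δ' : ℝ, δ ≤ δ' → δ' ≤ 1 → r ≤ Rmet X x δ' := by
  have hn : (0 : ℝ) < Fintype.card X := by
    exact_mod_cast Fintype.card_pos_iff.2 ⟨x⟩
  let large : ℝ → Prop := fun r =>
    δ * (Fintype.card X : ℝ) ≤ ((Finset.univ.filter (fun z => dist z x ≤ r)).card : ℝ)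
  have key : ∀ r, large r → ∃ w : X, dist w x ≤ r ∧ large (dist w x) := by
    intro r hr
    have hne : (Finset.univ.filter (fun z => dist z x ≤ r)).Nonempty := by
      rw [← Finset.card_pos]
      exact_mod_cast (mul_pos hδ hn).trans_le hr
    obtain ⟨w, hw, hmax⟩ := Finset.exists_max_image _ (fun z => dist z x) hne
    refine ⟨w, (Finset.mem_filter.1 hw).2, hr.trans ?_⟩
    exact_mod_cast Finset.card_le_card fun z hz =>
      Finset.mem_filter.2 ⟨Finset.mem_univ z, hmax z hz⟩
  have whole : ∃ r, 0 ≤ r ∧ ∀ z : X, dist z x ≤ r := by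
    obtain ⟨w, -, hw⟩ := Finset.exists_max_image Finset.univ (fun z => dist z x)
      ⟨x, Finset.mem_univ x⟩
    exact ⟨dist w x, dist_nonneg, fun z => hw z (Finset.mem_univ z)⟩
  obtain ⟨r₀, hr₀, hall⟩ := whole
  have hcard : ((Finset.univ.filter (fun z => dist z x ≤ r₀)).card : ℝ) = Fintype.card X := by
    rw [Finset.filter_true_of_mem fun z _ => hall z, Finset.card_univ]
  have hlarge : large r₀ := by
    change _ ≤ _
    rw [hcard]
    nlinarith
  obtain ⟨w₀, -, hw₀⟩ := key r₀ hlarge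
  obtain ⟨w, hw, hmin⟩ := Finset.exists_min_image
    (Finset.univ.filter fun z => large (dist z x)) (fun z => dist z x)
    ⟨w₀, Finset.mem_filter.2 ⟨Finset.mem_univ w₀, hw₀⟩⟩
  refine ⟨dist w x, dist_nonneg, (Finset.mem_filter.1 hw).2, fun δ' hδδ' hδ' => ?_⟩
  refine le_csInf ⟨r₀, hr₀, ?_⟩ ?_
  · rw [hcard]
    nlinarith
  · rintro r ⟨-, hr⟩
    obtain ⟨z, hzr, hz⟩ := key r ((mul_le_mul_of_nonneg_right hδδ' hn.le).trans hr)
    exact (hmin z (Finset.mem_filter.2 ⟨Finset.mem_univ z, hz⟩)).trans hzr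

/-- Density nets: at most `1/δ` points such that every `x` is within `2 R(x, δ')` of one of them,
for all `δ' ∈ [δ, 1]`. -/
theorem exists_density_net (X : Type*) [MetricSpace X] [Fintype X] {δ : ℝ}
    (hδ : 0 < δ) (hδ1 : δ ≤ 1) :
    ∃ N : Finset X, (N.card : ℝ) * δ ≤ 1 ∧
      ∀ x : X, ∃ y ∈ N, ∀ δ' : ℝ, δ ≤ δ' → δ' ≤ 1 → dist x y ≤ 2 * Rmet X x δ' := by
  choose r hr0 hr hrR using fun x : X => exists_radius_le_Rmet hδ hδ1 x
  obtain ⟨N, -, hdisj, hcov⟩ := exists_disjoint_subfamily_of_radius r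
    (fun x => Finset.univ.filter (fun z => dist z x ≤ r x)) Finset.univ
  refine ⟨N, ?_, fun x => ?_⟩
  · rcases isEmpty_or_nonempty X with hX | hX
    · simp [Finset.eq_empty_of_isEmpty N]
    have hn : (0 : ℝ) < Fintype.card X := by exact_mod_cast Fintype.card_pos
    have hsum : (N.card : ℝ) * (δ * Fintype.card X) ≤ Fintype.card X := by
      calc (N.card : ℝ) * (δ * Fintype.card X)
          ≤ ∑ y ∈ N, ((Finset.univ.filter (fun z => dist z y ≤ r y)).card : ℝ) := by
            rw [← nsmul_eq_mul]
            exact Finset.card_nsmul_le_sum _ _ _ fun y _ => hr y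
        _ = ((N.biUnion fun y => Finset.univ.filter (fun z => dist z y ≤ r y)).card : ℝ) := by
            rw [Finset.card_biUnion hdisj, Nat.cast_sum]
        _ ≤ Fintype.card X := by exact_mod_cast Finset.card_le_univ _
    nlinarith
  · rcases hcov x (Finset.mem_univ x) with hx | ⟨y, hy, hyx, hmeet⟩
    · refine ⟨x, hx, fun δ' h h' => ?_⟩
      have := hrR x δ' h h'
      have := hr0 x
      rw [dist_self]
      linarith
    · refine ⟨y, hy, fun δ' h h' => ?_⟩
      obtain ⟨z, hzx, hzy⟩ := Finset.not_disjoint_iff.1 hmeet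
      have h1 := (Finset.mem_filter.1 hzx).2
      have h2 := (Finset.mem_filter.1 hzy).2
      have := hrR x δ' h h'
      have := dist_triangle_left x y z
      linarith

/-- A finite type can be enumerated so that every member of an increasing sequence of finsets
is listed before its complement. -/
theorem exists_enumeration_of_monotone {X : Type*} [Fintype X] (M : ℕ → Finset X)
    (hM : Monotone M) :
    ∃ π : Fin (Fintype.card X) ≃ X, ∀ i k, π k ∈ M i → (k : ℕ) + 1 ≤ (M i).card := by
  obtain ⟨level, hlevel⟩ : ∃ level : X → WithTop ℕ, ∀ x (i : ℕ), x ∈ M i ↔ level x ≤ i := by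
    refine ⟨fun x => if h : ∃ i, x ∈ M i then (Nat.find h : WithTop ℕ) else ⊤, fun x i => ?_⟩
    by_cases h : ∃ i, x ∈ M i
    · simp only [h, dite_true, Nat.cast_le]
      exact ⟨fun hi => Nat.find_min' h hi, fun hi => hM hi (Nat.find_spec h)⟩
    · simp only [h, dite_false]
      refine ⟨fun hi => absurd ⟨i, hi⟩ h, fun hi => absurd hi (by simp)⟩
  let e := (Fintype.equivFin X).symm
  refine ⟨(Tuple.sort (level ∘ e)).trans e, fun i k hk => ?_⟩
  have hmono := Tuple.monotone_sort (level ∘ e)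
  rw [← Fin.card_Iic, ← Finset.card_map ((Tuple.sort (level ∘ e)).trans e).toEmbedding]
  refine Finset.card_le_card fun x hx => ?_
  obtain ⟨j, hj, rfl⟩ := Finset.mem_map.1 hx
  rw [hlevel] at hk
  exact (hlevel _ _).2 ((hmono (Finset.mem_Iic.1 hj)).trans hk)

/-- For every finite metric space `X` there is a priority ranking
`π : Fin n ≃ X` (the point of rank `j` being `π (j-1)`) such that every non-contractive
map `f : X → Y` with prioritized distortion `α` (monotone, nonnegative) satisfies: for
every `ε ∈ (0,1)` and every pair of distinct mutually `ε/2`-far points `u, v`,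
`d_Y(f u, f v) ≤ 5·α(⌈8/ε⌉)·d_X(u,v)`. -/
theorem stmt7 (X : Type) [MetricSpace X] [Fintype X] :
    ∃ π : Fin (Fintype.card X) ≃ X,
      ∀ (Y : Type) [MetricSpace Y] (α : ℕ → ℝ) (f : X → Y),
        Monotone α → (∀ j : ℕ, 0 ≤ α j) →
        (∀ x y : X, dist x y ≤ dist (f x) (f y)) →
        (∀ j i : Fin (Fintype.card X), j < i →
          dist (f (π j)) (f (π i)) ≤ α ((j : ℕ) + 1) * dist (π j) (π i)) →
        ∀ ε : ℝ, 0 < ε → ε < 1 → ∀ u v : X, u ≠ v →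
          Rmet X v (ε / 2) ≤ dist u v → Rmet X u (ε / 2) ≤ dist u v →
          dist (f u) (f v) ≤ 5 * α ⌈(8 : ℝ) / ε⌉₊ * dist u v := by
  choose N hNcard hN using fun i : ℕ =>
    exists_density_net X (δ := ((2 : ℝ) ^ i)⁻¹) (by positivity)
      (inv_le_one_of_one_le₀ (one_le_pow₀ one_le_two))
  have hNcard' : ∀ i, (N i).card ≤ 2 ^ i := fun i => by
    have h := hNcard i
    rw [← div_eq_mul_inv, div_le_one (by positivity)] at h
    exact_mod_cast h
  let M : ℕ → Finset X := fun i => (Finset.range (i + 1)).biUnion N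
  have hM : Monotone M := fun i j hij =>
    Finset.biUnion_subset_biUnion_of_subset_left N (Finset.range_mono (by omega))
  have hMcard : ∀ i, (M i).card ≤ 2 ^ (i + 1) := fun i => by
    refine Finset.card_biUnion_le.trans ((Finset.sum_le_sum fun j _ => hNcard' j).trans ?_)
    rw [Nat.geomSum_eq le_rfl]
    simp
  obtain ⟨π, hπ⟩ := exists_enumeration_of_monotone M hM
  refine ⟨π, fun Y _ α f hα hα0 _ hf ε hε hε1 u v _ _ hu => ?_⟩
  obtain ⟨m, hm, hm'⟩ := exists_nat_pow_near (x := 2 / ε) (y := (2 : ℝ))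
    ((one_le_div hε).2 (by linarith)) one_lt_two
  obtain ⟨w, hw, hwd⟩ := hN (m + 1) u
  have huw : dist u w ≤ 2 * dist u v := by
    refine (hwd (ε / 2) ?_ (by linarith)).trans (by linarith)
    rw [inv_le_comm₀ (by positivity) (by positivity), inv_div]
    exact hm'.le
  obtain ⟨k, rfl⟩ := π.surjective w
  have hk : (k : ℕ) + 1 ≤ ⌈(8 : ℝ) / ε⌉₊ := by
    have h1 := (hπ (m + 1) k
      (Finset.mem_biUnion.2 ⟨m + 1, by simp, hw⟩)).trans (hMcard (m + 1))
    have h2 : (((k : ℕ) + 1 : ℕ) : ℝ) ≤ 8 / ε := by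
      calc (((k : ℕ) + 1 : ℕ) : ℝ) ≤ 2 ^ (m + 1 + 1) := by exact_mod_cast h1
        _ = 4 * 2 ^ m := by ring
        _ ≤ 4 * (2 / ε) := by linarith
        _ = 8 / ε := by ring
    exact_mod_cast h2.trans (Nat.le_ceil _)
  have hpivot : ∀ x, dist (f (π k)) (f x) ≤ α ⌈(8 : ℝ) / ε⌉₊ * dist (π k) x := by
    intro x
    obtain ⟨l, rfl⟩ := π.surjective x
    rcases lt_trichotomy k l with h | rfl | h
    · exact (hf k l h).trans (mul_le_mul_of_nonneg_right (hα hk) dist_nonneg)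
    · simp
    · rw [dist_comm, dist_comm (π k)]
      refine (hf l k h).trans (mul_le_mul_of_nonneg_right (hα ?_) dist_nonneg)
      have : (l : ℕ) < k := h
      omega
  have hA := hα0 ⌈(8 : ℝ) / ε⌉₊
  calc dist (f u) (f v)
      ≤ dist (f (π k)) (f u) + dist (f (π k)) (f v) := dist_triangle_left _ _ _
    _ ≤ α ⌈(8 : ℝ) / ε⌉₊ * (dist (π k) u + dist (π k) v) := by
        rw [mul_add]
        exact add_le_add (hpivot u) (hpivot v)
    _ ≤ α ⌈(8 : ℝ) / ε⌉₊ * (5 * dist u v) := by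
        refine mul_le_mul_of_nonneg_left ?_ hA
        have := dist_triangle (π k) u v
        rw [dist_comm (π k) u] at *
        linarith
    _ = 5 * α ⌈(8 : ℝ) / ε⌉₊ * dist u v := by ring
end

section
/- For every finite metric space (X,d) with n = |X| points and every parameter 0 < ε < 1, there exists a subset N ⊆ X such that |N| ≤ 1/ε and for every v ∈ X there exists u ∈ N with d(v,u) ≤ 2·R(v,ε). -/
open Finset

attribute [local instance] Classical.propDecidable

lemma Rmet_nonneg (X : Type*) [MetricSpace X] [Fintype X] (x : X) (ε : ℝ) : 0 ≤ Rmet X x ε :=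
  Real.sInf_nonneg fun _ hr => hr.1

/-- The infimum defining `Rmet` is attained. -/
lemma mul_card_le_card_closedBall_Rmet (X : Type*) [MetricSpace X] [Fintype X] (x : X) {ε : ℝ}
    (hε : ε ≤ 1) :
    ε * (Fintype.card X : ℝ) ≤
      ((Finset.univ.filter (fun z => dist z x ≤ Rmet X x ε)).card : ℝ) := by
  set S : Set ℝ := {r : ℝ | 0 ≤ r ∧
    ε * (Fintype.card X : ℝ) ≤ ((Finset.univ.filter (fun z => dist z x ≤ r)).card : ℝ)}
  have hR : Rmet X x ε = sInf S := rfl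
  have hne : S.Nonempty := by
    obtain ⟨M, hM⟩ := (Set.finite_range fun z => dist z x).bddAbove
    have hM' : ∀ z, dist z x ≤ M := fun z => hM ⟨z, rfl⟩
    refine ⟨M, dist_nonneg.trans (hM' x), ?_⟩
    rw [Finset.filter_true_of_mem fun z _ => hM' z, Finset.card_univ]
    exact mul_le_of_le_one_left (Nat.cast_nonneg _) hε
  have hev : ∀ᶠ r in nhds (Rmet X x ε), ∀ z, dist z x ≤ r → dist z x ≤ Rmet X x ε := by
    refine Filter.eventually_all.2 fun z => ?_
    by_cases h : dist z x ≤ Rmet X x ε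
    · exact Filter.Eventually.of_forall fun _ _ => h
    · filter_upwards [eventually_lt_nhds (not_le.1 h)] with r hr hz
      exact absurd hz hr.not_ge
  obtain ⟨δ, hδ, hball⟩ := Metric.eventually_nhds_iff.1 hev
  obtain ⟨r, hrS, hr⟩ := exists_lt_of_csInf_lt hne (lt_add_of_pos_right (sInf S) hδ)
  have hle : sInf S ≤ r := csInf_le ⟨0, fun _ h => h.1⟩ hrS
  have hrδ : dist r (Rmet X x ε) < δ := by
    rw [Real.dist_eq, hR, abs_of_nonneg (sub_nonneg.2 hle)]
    linarith
  refine hrS.2.trans (Nat.cast_le.2 (Finset.card_le_card ?_))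
  exact Finset.monotone_filter_right _ fun z _ hz => hball hrδ z hz

/-- Greedy selection of disjoint closed balls in order of increasing radius. -/
lemma exists_pairwiseDisjoint_closedBall_cover {X : Type*} [MetricSpace X] [Fintype X] (ρ : X → ℝ)
    (hρ : ∀ x, 0 ≤ ρ x) (T : Finset X) :
    ∃ N ⊆ T,
      (N : Set X).PairwiseDisjoint (fun x => Finset.univ.filter (fun z => dist z x ≤ ρ x)) ∧
      ∀ v ∈ T, ∃ u ∈ N, dist v u ≤ 2 * ρ v := by
  induction T using Finset.induction_on_max_value ρ with
  | empty => exact ⟨∅, by simp⟩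
  | insert a s _ hmax ih =>
    obtain ⟨N, hNs, hdisj, hcov⟩ := ih
    by_cases h : ∃ u ∈ N, ∃ z, dist z a ≤ ρ a ∧ dist z u ≤ ρ u
    · obtain ⟨u, hu, z, hza, hzu⟩ := h
      refine ⟨N, hNs.trans (Finset.subset_insert _ _), hdisj, fun v hv => ?_⟩
      obtain rfl | hv := Finset.mem_insert.1 hv
      · refine ⟨u, hu, ?_⟩
        linarith [dist_triangle_left v u z, hmax u (hNs hu)]
      · exact hcov v hv
    · refine ⟨insert a N, Finset.insert_subset_insert _ hNs, ?_, fun v hv => ?_⟩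
      · rw [Finset.coe_insert]
        refine hdisj.insert fun u hu _ => Finset.disjoint_left.2 fun z hza hzu => h ⟨u, hu, z, ?_⟩
        exact ⟨(Finset.mem_filter.1 hza).2, (Finset.mem_filter.1 hzu).2⟩
      · obtain rfl | hv := Finset.mem_insert.1 hv
        · exact ⟨v, Finset.mem_insert_self _ _, by simpa using hρ v⟩
        · obtain ⟨u, hu, huv⟩ := hcov v hv
          exact ⟨u, Finset.mem_insert_of_mem hu, huv⟩

/-- (Density nets.) Every finite metric space `X` and `0 < ε < 1` admit
an `ε`-density-net: a set `N` with `|N| ≤ 1/ε` such that every `v ∈ X` has `u ∈ N` with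
`d(v,u) ≤ 2·R(v,ε)`. -/
theorem stmt8 (X : Type) [MetricSpace X] [Fintype X] (ε : ℝ) (hε0 : 0 < ε) (hε1 : ε < 1) :
    ∃ N : Finset X, ((N.card : ℝ) ≤ 1 / ε ∧
      ∀ v : X, ∃ u ∈ N, dist v u ≤ 2 * Rmet X v ε) := by
  obtain ⟨N, -, hdisj, hcov⟩ := exists_pairwiseDisjoint_closedBall_cover
    (fun x => Rmet X x ε) (fun x => Rmet_nonneg X x ε) Finset.univ
  refine ⟨N, ?_, fun v => hcov v (Finset.mem_univ v)⟩
  rcases isEmpty_or_nonempty X with hX | hX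
  · rw [Finset.eq_empty_of_isEmpty N, Finset.card_empty, Nat.cast_zero]
    positivity
  have hn : (0 : ℝ) < Fintype.card X := Nat.cast_pos.2 Fintype.card_pos
  have hsum : (N.card : ℝ) * (ε * Fintype.card X) ≤ Fintype.card X := by
    calc (N.card : ℝ) * (ε * Fintype.card X)
        = ∑ _x ∈ N, ε * (Fintype.card X : ℝ) := by rw [Finset.sum_const, nsmul_eq_mul]
      _ ≤ ∑ x ∈ N, ((Finset.univ.filter (fun z => dist z x ≤ Rmet X x ε)).card : ℝ) :=
          Finset.sum_le_sum fun x _ => mul_card_le_card_closedBall_Rmet X x hε1.le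
      _ = ((N.biUnion fun x => Finset.univ.filter
            (fun z => dist z x ≤ Rmet X x ε)).card : ℝ) := by
          rw [Finset.card_biUnion hdisj, Nat.cast_sum]
      _ ≤ Fintype.card X := Nat.cast_le.2 (Finset.card_le_univ _)
  rw [le_div_iff₀ hε0]
  refine le_of_mul_le_mul_right ?_ hn
  linarith
end
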